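/- arXiv:0902.2413 — 2 statements merged into one kernel-verified Lean document; each statement's English description precedes it below -/
import Mathlib

section
/- Let S_N(E) := ln[ (2π/N)^{3N/2} · (N!·Γ(3N/2))⁻¹ · ∫_{Λ^N} (E − I_N(q))₊^{3N/2−1} dq ] be Boltzmann's microcanonical entropy of the Hamiltonian H_N(p,q) = N·Σ_{1≤i≤N} ½|p_i|² + I_N(q) (obtained by carrying out the momentum integrations in (1/N!)∫ δ(E − H_N) dp dq). Then there exists a continuous, strictly increasing function s : (ε_g, ∞) → ℝ such that for every ε > ε_g one has the asymptotic expansion S_N(N²ε) = −N·ln N + N·s(ε) + o(N) as N → ∞; equivalently, (S_N(N²ε) + N·ln N)/N → s(ε) for every ε > ε_g. -/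
open MeasureTheory Real Filter Set
open scoped BigOperators ENNReal

noncomputable section

abbrev Euc : Type := EuclideanSpace ℝ (Fin 3)

/-- Interaction energy `I_N(q) = ∑_{i<j} U(q_i, q_j)`. -/
def interaction (U : Euc → Euc → ℝ) (N : ℕ) (q : Fin N → Euc) : ℝ :=
  ∑ i : Fin N, ∑ j : Fin N, if (i : ℕ) < (j : ℕ) then U (q i) (q j) else 0

/-- The bilinear pairing `⟨ρ,ρ'⟩ = ∬ ½ U(x,y) ρ(dx) ρ'(dy)`. -/
def pairing (U : Euc → Euc → ℝ) (ρ ρ' : Measure Euc) : ℝ :=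
  ∫ x, ∫ y, U x y / 2 ∂ρ' ∂ρ

/-- A Borel probability measure concentrated on `cl(Λ)`. -/
def IsProbOn (Λ : Set Euc) (ρ : Measure Euc) : Prop :=
  IsProbabilityMeasure ρ ∧ ρ ((closure Λ)ᶜ) = 0

/-- `ε_g`, the infimum of `⟨ρ,ρ⟩` over Borel probability measures on `cl(Λ)`. -/
def groundEnergy (U : Euc → Euc → ℝ) (Λ : Set Euc) : ℝ :=
  sInf { e : ℝ | ∃ ρ : Measure Euc, IsProbOn Λ ρ ∧ e = pairing U ρ ρ }

/-- Boltzmann's microcanonical entropy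
`S_N(E) = ln[(2π/N)^{3N/2} (N! Γ(3N/2))⁻¹ ∫_{Λ^N} (E − I_N(q))₊^{3N/2−1} dq]`,
obtained by carrying out the momentum integrations in `(1/N!) ∫ δ(E − H_N) dp dq`. -/
def mcEntropy (U : Euc → Euc → ℝ) (Λ : Set Euc) (N : ℕ) (E : ℝ) : ℝ :=
  Real.log ((2 * π / N) ^ ((3 * (N : ℝ)) / 2) *
      ((N.factorial : ℝ) * Real.Gamma (3 * (N : ℝ) / 2))⁻¹ *
    ∫ q : Fin N → Euc in Set.univ.pi fun _ => Λ,
      (max (E - interaction U N q) 0) ^ ((3 * (N : ℝ)) / 2 - 1) ∂volume)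


/-! ### Asymptotics of the prefactor -/

theorem tendsto_log_div_nat :
    Tendsto (fun N : ℕ => Real.log N / (N : ℝ)) atTop (nhds 0) := by
  have h := Real.isLittleO_log_id_atTop.tendsto_div_nhds_zero.comp
    (tendsto_natCast_atTop_atTop (R := ℝ))
  simpa [Function.comp_def] using h

theorem tendsto_log_factorial_div_sub_log :
    Tendsto (fun N : ℕ => Real.log (N.factorial : ℝ) / N - Real.log N) atTop (nhds (-1)) := by
  have h1 : Tendsto (fun N : ℕ => Real.log (Stirling.stirlingSeq N) / (N : ℝ)) atTop (nhds 0) :=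
    (Stirling.tendsto_stirlingSeq_sqrt_pi.log (by positivity)).div_atTop
      tendsto_natCast_atTop_atTop
  have h2 : Tendsto (fun N : ℕ => Real.log 2 / 2 / (N : ℝ)) atTop (nhds 0) :=
    tendsto_const_div_atTop_nhds_zero_nat _
  have h3 := ((h1.add h2).add (tendsto_log_div_nat.div_const 2)).sub_const 1
  simp only [zero_div, add_zero, zero_sub] at h3
  refine h3.congr' ?_
  filter_upwards [eventually_gt_atTop 0] with N hN
  have hN' : (0 : ℝ) < N := by exact_mod_cast hN
  rw [Stirling.log_stirlingSeq_formula, Real.log_mul (by norm_num) hN'.ne',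
    Real.log_div hN'.ne' (Real.exp_pos 1).ne', Real.log_exp]
  field_simp
  ring

/-- Legendre's duplication formula together with monotonicity of `Γ`. -/
theorem log_Gamma_three_halves_bounds (N : ℕ) (hN : 2 ≤ N) :
    (1 - 3 * (N : ℝ)) * Real.log 2 + Real.log π / 2 + Real.log ((3 * N).factorial : ℝ)
        - Real.log (3 * N) - Real.log (3 * N / 2) ≤ 2 * Real.log (Real.Gamma (3 * N / 2)) ∧
      2 * Real.log (Real.Gamma (3 * N / 2)) ≤
        (1 - 3 * (N : ℝ)) * Real.log 2 + Real.log π / 2 + Real.log ((3 * N).factorial : ℝ)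
        - Real.log (3 * N) := by
  have hN' : (2 : ℝ) ≤ N := by exact_mod_cast hN
  set x : ℝ := 3 * N / 2 with hx
  have hx3 : (3 : ℝ) ≤ x := by rw [hx]; linarith
  have hG : 0 < Real.Gamma x := Real.Gamma_pos_of_pos (by linarith)
  have hG' : 0 < Real.Gamma (x + 1 / 2) := Real.Gamma_pos_of_pos (by linarith)
  have hdup := Real.Gamma_mul_Gamma_add_half x
  have hfac : Real.Gamma (2 * x) * (3 * N) = ((3 * N).factorial : ℝ) := by
    rw [← Real.Gamma_nat_eq_factorial]
    push_cast
    rw [Real.Gamma_add_one (by positivity), hx]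
    ring_nf
  have hG2 : 0 < Real.Gamma (2 * x) := Real.Gamma_pos_of_pos (by linarith)
  have hlog : Real.log (Real.Gamma x) + Real.log (Real.Gamma (x + 1 / 2)) =
      (1 - 3 * (N : ℝ)) * Real.log 2 + Real.log π / 2 + Real.log ((3 * N).factorial : ℝ)
        - Real.log (3 * N) := by
    rw [← Real.log_mul hG.ne' hG'.ne', hdup, ← hfac, Real.log_mul hG2.ne' (by positivity),
      Real.log_mul (by positivity) (by positivity), Real.log_mul hG2.ne' (by positivity),
      Real.log_rpow (by norm_num), Real.log_sqrt (by positivity), hx]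
    ring
  have h1 : Real.Gamma x ≤ Real.Gamma (x + 1 / 2) :=
    Real.Gamma_strictMonoOn_Ici.monotoneOn (by simp; linarith) (by simp; linarith) (by linarith)
  have h2 : Real.Gamma (x + 1 / 2) ≤ x * Real.Gamma x := by
    rw [← Real.Gamma_add_one (by linarith)]
    exact Real.Gamma_strictMonoOn_Ici.monotoneOn (by simp; linarith) (by simp; linarith)
      (by linarith)
  have h1' := Real.log_le_log hG h1
  have h2' := Real.log_le_log hG' h2
  rw [Real.log_mul (by linarith) hG.ne'] at h2'
  constructor <;> linarith

theorem exists_tendsto_log_Gamma :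
    ∃ C : ℝ, Tendsto (fun N : ℕ => Real.log (Real.Gamma (3 * (N : ℝ) / 2)) / N
      - 3 / 2 * Real.log N) atTop (nhds C) := by
  have hmul : Tendsto (fun N : ℕ => 3 * N) atTop atTop :=
    tendsto_id.const_mul_atTop' (by norm_num : 0 < 3)
  have hf := (tendsto_log_factorial_div_sub_log.comp hmul).const_mul 3
  have hl := (tendsto_log_div_nat.comp hmul).const_mul 3
  have h2 : Tendsto (fun N : ℕ => (Real.log 2 + Real.log π / 2) / (N : ℝ)) atTop (nhds 0) :=
    tendsto_const_div_atTop_nhds_zero_nat _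
  have h3 : Tendsto (fun N : ℕ => Real.log 2 / (N : ℝ)) atTop (nhds 0) :=
    tendsto_const_div_atTop_nhds_zero_nat _
  have hup := ((((h2.add hf).sub hl).add_const (3 * Real.log 3 - 3 * Real.log 2)).div_const 2)
  have hlo := ((((h2.add hf).sub (hl.const_mul 2)).add h3).add_const
    (3 * Real.log 3 - 3 * Real.log 2)).div_const 2
  simp only [mul_zero, sub_zero, add_zero] at hup hlo
  refine ⟨_, tendsto_of_tendsto_of_tendsto_of_le_of_le' hlo hup ?_ ?_⟩
  · filter_upwards [eventually_ge_atTop 2] with N hN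
    have hN' : (0 : ℝ) < N := by exact_mod_cast (by omega : 0 < N)
    have h := (log_Gamma_three_halves_bounds N hN).1
    rw [Real.log_div (by positivity) (by norm_num)] at h
    simp only [Function.comp_apply]
    push_cast
    rw [div_le_iff₀ (by norm_num), ← sub_nonneg]
    have e : Real.log (3 * (N : ℝ)) = Real.log 3 + Real.log N :=
      Real.log_mul (by norm_num) hN'.ne'
    have := div_nonneg (sub_nonneg.2 h) hN'.le
    convert this using 1
    rw [e]
    field_simp
    ring
  · filter_upwards [eventually_ge_atTop 2] with N hN
    have hN' : (0 : ℝ) < N := by exact_mod_cast (by omega : 0 < N)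
    have h := (log_Gamma_three_halves_bounds N hN).2
    simp only [Function.comp_apply]
    push_cast
    rw [le_div_iff₀ (by norm_num), ← sub_nonneg]
    have e : Real.log (3 * (N : ℝ)) = Real.log 3 + Real.log N :=
      Real.log_mul (by norm_num) hN'.ne'
    have := div_nonneg (sub_nonneg.2 h) hN'.le
    convert this using 1
    rw [e]
    field_simp
    ring

theorem exists_tendsto_log_prefactor :
    ∃ C : ℝ, Tendsto (fun N : ℕ =>
      Real.log ((2 * π / N) ^ ((3 * (N : ℝ)) / 2) *
        ((N.factorial : ℝ) * Real.Gamma (3 * (N : ℝ) / 2))⁻¹ *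
        ((N : ℝ) ^ 2) ^ ((3 * (N : ℝ)) / 2 - 1)) / N + Real.log N) atTop (nhds C) := by
  obtain ⟨C, hC⟩ := exists_tendsto_log_Gamma
  have h := ((tendsto_log_factorial_div_sub_log.add hC).add
    (tendsto_log_div_nat.const_mul 2)).const_sub (3 / 2 * Real.log (2 * π))
  refine ⟨_, h.congr' ?_⟩
  filter_upwards [eventually_ge_atTop 2] with N hN
  have hN' : (0 : ℝ) < N := by exact_mod_cast (by omega : 0 < N)
  have hG : 0 < Real.Gamma (3 * (N : ℝ) / 2) := Real.Gamma_pos_of_pos (by positivity)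
  have hF : (0 : ℝ) < N.factorial := by exact_mod_cast N.factorial_pos
  rw [Real.log_mul (x := _ * _⁻¹) (by positivity) (by positivity),
    Real.log_mul (y := _⁻¹) (by positivity) (by positivity),
    Real.log_inv, Real.log_mul hF.ne' hG.ne', Real.log_rpow (by positivity),
    Real.log_rpow (by positivity), Real.log_pow, Real.log_div (by positivity) hN'.ne']
  push_cast
  field_simp
  ring

/-! ### Convergence of almost superadditive families -/

theorem exists_tendsto_of_eventually_sub_le {u : ℕ → ℝ}
    (h : ∀ δ > 0, ∀ᶠ N in atTop, ∀ᶠ M in atTop, u N - δ ≤ u M)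
    {C : ℝ} (hC : ∀ᶠ N in atTop, u N ≤ C) : ∃ l, Tendsto u atTop (nhds l) := by
  obtain ⟨N₀, hN₀⟩ := (h 1 one_pos).exists
  have hb : IsBoundedUnder (· ≥ ·) atTop u := ⟨_, hN₀⟩
  have hB : IsBoundedUnder (· ≤ ·) atTop u := ⟨C, hC⟩
  refine ⟨_, tendsto_of_le_liminf_of_limsup_le le_rfl ?_ hB hb⟩
  refine le_of_forall_pos_le_add fun δ hδ => ?_
  refine limsup_le_of_le hb.isCoboundedUnder_flip ?_
  filter_upwards [h δ hδ] with N hN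
  have := le_liminf_of_le hB.isCoboundedUnder_flip hN
  linarith

theorem exists_limit_of_almost_superadditive {f : ℕ → ℝ → ℝ} {e₀ : ℝ} (he₀ : 0 ≤ e₀)
    (hsup : ∀ ε > e₀, ∀ η > 0, ∀ δ > 0, ∀ᶠ N in atTop, ∀ᶠ M in atTop, f N ε - δ ≤ f M (ε + η))
    (hbdd : ∀ ε > e₀, ∃ C, ∀ᶠ N in atTop, f N ε ≤ C)
    (hgrow : ∀ ε ε', e₀ < ε → ε < ε' →
      ∀ᶠ N : ℕ in atTop, f N ε + (3 / 2 - 1 / (N : ℝ)) * Real.log (ε' / ε) ≤ f N ε')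
    (hcont : ∀ ε₀ > e₀, ∃ δ₀ > 0, ∀ᶠ N : ℕ in atTop, ∀ ε ε', ε₀ ≤ ε → ε < ε' → ε' < ε + δ₀ →
      f N ε' ≤ f N ε - 3 / 2 * Real.log (1 - (ε' - ε) / δ₀) + Real.log 2 / N) :
    ∃ s : ℝ → ℝ, ContinuousOn s (Ioi e₀) ∧ StrictMonoOn s (Ioi e₀) ∧
      ∀ ε > e₀, Tendsto (fun N => f N ε) atTop (nhds (s ε)) := by
  have hlog2 : Tendsto (fun N : ℕ => Real.log 2 / (N : ℝ)) atTop (nhds 0) :=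
    tendsto_const_div_atTop_nhds_zero_nat _
  have hmod : ∀ δ₀ > (0 : ℝ),
      Tendsto (fun t : ℝ => -(3 / 2 * Real.log (1 - t / δ₀))) (nhds 0) (nhds 0) := by
    intro δ₀ hδ₀
    have : ContinuousAt (fun t : ℝ => -(3 / 2 * Real.log (1 - t / δ₀))) 0 := by
      refine (continuousAt_const.mul (ContinuousAt.log (by fun_prop) (by simp))).neg
    simpa [ContinuousAt] using this
  have hlim : ∀ ε > e₀, ∃ l, Tendsto (fun N => f N ε) atTop (nhds l) := by
    intro ε hε
    obtain ⟨C, hC⟩ := hbdd ε hε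
    refine exists_tendsto_of_eventually_sub_le (fun δ hδ => ?_) hC
    obtain ⟨ε₀, h₀, h₁⟩ := exists_between hε
    obtain ⟨δ₀, hδ₀, hD⟩ := hcont ε₀ h₀
    have hev : ∀ᶠ t in nhdsWithin (0 : ℝ) (Ioi 0),
        -(3 / 2 * Real.log (1 - t / δ₀)) < δ / 3 ∧ t < δ₀ ∧ t < ε - ε₀ ∧ 0 < t := by
      have h1 := ((hmod δ₀ hδ₀).eventually (gt_mem_nhds (by positivity : (0 : ℝ) < δ / 3)))
      have h2 := gt_mem_nhds hδ₀
      have h3 := gt_mem_nhds (sub_pos.2 h₁)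
      filter_upwards [nhdsWithin_le_nhds h1, nhdsWithin_le_nhds h2, nhdsWithin_le_nhds h3,
        self_mem_nhdsWithin] with t a b c d using ⟨a, b, c, d⟩
    obtain ⟨η, hη1, hη2, hη3, hη0⟩ := hev.exists
    have hB := hsup (ε - η) (by linarith) η hη0 (δ / 3) (by positivity)
    filter_upwards [hB, hD, hlog2.eventually (gt_mem_nhds (by positivity : (0 : ℝ) < δ / 3))]
      with N h1 h2 h3
    have h4 := h2 (ε - η) ε (by linarith) (by linarith) (by linarith)
    rw [sub_sub_cancel] at h4
    filter_upwards [h1] with M hM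
    rw [sub_add_cancel] at hM
    linarith
  choose! s hs using hlim
  have hsgrow : ∀ ε ε', e₀ < ε → ε < ε' → s ε + 3 / 2 * Real.log (ε' / ε) ≤ s ε' := by
    intro ε ε' h1 h2
    have ht : Tendsto (fun N : ℕ => f N ε + (3 / 2 - 1 / (N : ℝ)) * Real.log (ε' / ε)) atTop
        (nhds (s ε + (3 / 2 - 0) * Real.log (ε' / ε))) :=
      (hs ε h1).add ((tendsto_const_nhds.sub tendsto_one_div_atTop_nhds_zero_nat).mul_const _)
    rw [sub_zero] at ht
    exact le_of_tendsto_of_tendsto ht (hs ε' (h1.trans h2)) (hgrow ε ε' h1 h2)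
  have hmono : StrictMonoOn s (Ioi e₀) := by
    intro ε h1 ε' _ h2
    have h1' : e₀ < ε := h1
    have : 0 < Real.log (ε' / ε) := Real.log_pos ((one_lt_div (by linarith)).2 h2)
    linarith [hsgrow ε ε' h1 h2]
  refine ⟨s, ?_, hmono, hs⟩
  intro ε hε
  refine ContinuousAt.continuousWithinAt ?_
  obtain ⟨ε₀, h₀, h₁⟩ := exists_between (show e₀ < ε from hε)
  obtain ⟨δ₀, hδ₀, hD⟩ := hcont ε₀ h₀
  have hsD : ∀ x y, ε₀ ≤ x → x < y → y < x + δ₀ →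
      s y ≤ s x - 3 / 2 * Real.log (1 - (y - x) / δ₀) := by
    intro x y h1 h2 h3
    have ht := ((hs x (by linarith)).sub_const (3 / 2 * Real.log (1 - (y - x) / δ₀))).add hlog2
    rw [add_zero] at ht
    refine le_of_tendsto_of_tendsto (hs y (by linarith)) ht ?_
    filter_upwards [hD] with N hN using hN x y h1 h2 h3
  rw [ContinuousAt, tendsto_iff_dist_tendsto_zero]
  have habs : Tendsto (fun y : ℝ => |y - ε|) (nhds ε) (nhds 0) := by
    have : Continuous fun y : ℝ => |y - ε| := by fun_prop
    simpa using this.tendsto ε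
  refine squeeze_zero' (Eventually.of_forall fun _ => dist_nonneg) ?_ ((hmod δ₀ hδ₀).comp habs)
  have hball : ∀ᶠ y in nhds ε, |y - ε| < δ₀ := habs.eventually (gt_mem_nhds hδ₀)
  filter_upwards [hball, lt_mem_nhds h₁] with y hy hy'
  rw [Real.dist_eq, Function.comp_apply]
  rcases lt_trichotomy y ε with h | rfl | h
  · rw [abs_of_neg (sub_neg.2 h)] at hy ⊢
    have := hmono (show e₀ < y by linarith) hε h
    rw [abs_of_neg (sub_neg.2 this)]
    have := hsD y ε hy'.le h (by linarith)
    rw [neg_sub, neg_sub]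
    linarith
  · simp
  · rw [abs_of_pos (sub_pos.2 h)] at hy ⊢
    have := hmono hε (show e₀ < y by linarith) h
    rw [abs_of_pos (sub_pos.2 this)]
    have := hsD ε y h₁.le h (by linarith)
    linarith

/-! ### Integrals of powers of the available kinetic energy -/

/-- The integral `∫ (ε - X)₊ ^ a dμ`. -/
def truncPowInt {α : Type*} [MeasurableSpace α] (μ : Measure α) (X : α → ℝ) (a ε : ℝ) : ℝ :=
  ∫ q, (max (ε - X q) 0) ^ a ∂μ

section TruncPowInt

variable {α : Type*} [MeasurableSpace α] {μ : Measure α} {X : α → ℝ} {a ε ε' δ₀ : ℝ}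

theorem ae_truncPow_le (hX0 : 0 ≤ᵐ[μ] X) (ha : 0 ≤ a) :
    ∀ᵐ q ∂μ, (max (ε - X q) 0) ^ a ≤ (max ε 0) ^ a := by
  filter_upwards [hX0] with q hq
  have hq' : 0 ≤ X q := hq
  exact Real.rpow_le_rpow (le_max_right _ _) (max_le_max (by linarith) le_rfl) ha

variable [IsFiniteMeasure μ]

theorem integrable_truncPow (hX : AEMeasurable X μ) (hX0 : 0 ≤ᵐ[μ] X) (ha : 0 ≤ a) :
    Integrable (fun q => (max (ε - X q) 0) ^ a) μ := by
  refine Integrable.of_bound (C := (max ε 0) ^ a) ?_ ?_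
  · exact (((aemeasurable_const.sub hX).max aemeasurable_const).pow_const a).aestronglyMeasurable
  · filter_upwards [ae_truncPow_le hX0 ha] with q hq
    rwa [Real.norm_of_nonneg (Real.rpow_nonneg (le_max_right _ _) _)]

theorem truncPowInt_le (hX : AEMeasurable X μ) (hX0 : 0 ≤ᵐ[μ] X) (ha : 0 ≤ a) (hε : 0 ≤ ε) :
    truncPowInt μ X a ε ≤ μ.real univ * ε ^ a := by
  have := integral_mono_ae (integrable_truncPow hX hX0 ha) (integrable_const _)
    (ae_truncPow_le (ε := ε) hX0 ha)
  rwa [integral_const, smul_eq_mul, max_eq_left hε] at this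

theorem truncPowInt_mono (hX : AEMeasurable X μ) (hX0 : 0 ≤ᵐ[μ] X) (ha : 0 ≤ a) (h : ε ≤ ε') :
    truncPowInt μ X a ε ≤ truncPowInt μ X a ε' := by
  refine integral_mono (integrable_truncPow hX hX0 ha) (integrable_truncPow hX hX0 ha) fun q => ?_
  exact Real.rpow_le_rpow (le_max_right _ _) (max_le_max (by linarith) le_rfl) ha

theorem rpow_mul_truncPowInt_le (hX : AEMeasurable X μ) (hX0 : 0 ≤ᵐ[μ] X) (ha : 0 ≤ a)
    (hε : 0 < ε) (h : ε ≤ ε') :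
    (ε' / ε) ^ a * truncPowInt μ X a ε ≤ truncPowInt μ X a ε' := by
  rw [truncPowInt, ← integral_const_mul]
  refine integral_mono_ae ((integrable_truncPow hX hX0 ha).const_mul _)
    (integrable_truncPow hX hX0 ha) ?_
  filter_upwards [hX0] with q hq
  have hq' : 0 ≤ X q := hq
  rw [← Real.mul_rpow (div_nonneg (by linarith) hε.le) (le_max_right _ _)]
  refine Real.rpow_le_rpow (mul_nonneg (div_nonneg (by linarith) hε.le) (le_max_right _ _)) ?_ ha
  rw [mul_max_of_nonneg _ _ (div_nonneg (by linarith) hε.le), mul_zero]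
  refine max_le_max ?_ le_rfl
  rw [div_mul_eq_mul_div, div_le_iff₀ hε]
  nlinarith

theorem truncPowInt_le_add (hX : AEMeasurable X μ) (hX0 : 0 ≤ᵐ[μ] X) (ha : 0 ≤ a)
    (hδ₀ : 0 < δ₀) (h : ε ≤ ε') (h' : ε' < ε + δ₀) :
    truncPowInt μ X a ε' ≤
      μ.real univ * δ₀ ^ a + ((1 - (ε' - ε) / δ₀) ^ a)⁻¹ * truncPowInt μ X a ε := by
  have hθ : 0 < 1 - (ε' - ε) / δ₀ := by
    rw [sub_pos, div_lt_one hδ₀]; linarith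
  set θ := 1 - (ε' - ε) / δ₀ with hθdef
  rw [truncPowInt, truncPowInt, ← integral_const_mul, ← smul_eq_mul (μ.real univ),
    ← integral_const, ← integral_add (integrable_const _)
      ((integrable_truncPow hX hX0 ha).const_mul _)]
  refine integral_mono (integrable_truncPow hX hX0 ha)
    ((integrable_const _).add ((integrable_truncPow hX hX0 ha).const_mul _)) fun q => ?_
  have hn : 0 ≤ (max (ε - X q) 0) ^ a := Real.rpow_nonneg (le_max_right _ _) _
  have hθa : 0 < θ ^ a := Real.rpow_pos_of_pos hθ a
  rcases le_total (ε' - X q) δ₀ with hc | hc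
  · have : (max (ε' - X q) 0) ^ a ≤ δ₀ ^ a :=
      Real.rpow_le_rpow (le_max_right _ _) (max_le hc hδ₀.le) ha
    have h2 := mul_nonneg (inv_nonneg.2 hθa.le) hn
    simp only
    linarith
  · have h1 : max (ε' - X q) 0 * θ ≤ max (ε - X q) 0 := by
      rw [max_eq_left (by linarith)]
      refine le_trans ?_ (le_max_left _ _)
      have : (ε' - ε) ≤ (ε' - X q) * ((ε' - ε) / δ₀) := by
        rw [mul_div_assoc', le_div_iff₀ hδ₀]
        nlinarith
      rw [hθdef]
      linarith
    have h2 := Real.rpow_le_rpow (mul_nonneg (le_max_right _ _) hθ.le) h1 ha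
    rw [Real.mul_rpow (le_max_right _ _) hθ.le] at h2
    have h3 : 0 ≤ δ₀ ^ a := Real.rpow_nonneg hδ₀.le a
    simp only
    rw [← div_eq_inv_mul]
    have := (le_div_iff₀ hθa).2 h2
    linarith

end TruncPowInt

theorem exists_limit_log_truncPowInt {α : ℕ → Type*} [∀ N, MeasurableSpace (α N)]
    (μ : ∀ N, Measure (α N)) [∀ N, IsFiniteMeasure (μ N)] (X : ∀ N, α N → ℝ)
    (hX : ∀ N, AEMeasurable (X N) (μ N)) (hX0 : ∀ N, 0 ≤ᵐ[μ N] X N)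
    {v : ℝ} (hv : 0 < v) (hμ : ∀ N, (μ N).real univ = v ^ N) {e₀ : ℝ} (he₀ : 0 ≤ e₀)
    (hpos : ∀ ε > e₀, ∀ N : ℕ, 0 < N → 0 < truncPowInt (μ N) (X N) (3 * (N : ℝ) / 2 - 1) ε)
    (hsup : ∀ ε > e₀, ∀ η > 0, ∀ δ > 0, ∀ᶠ N : ℕ in atTop, ∀ᶠ M : ℕ in atTop,
      Real.log (truncPowInt (μ N) (X N) (3 * (N : ℝ) / 2 - 1) ε) / N - δ ≤
      Real.log (truncPowInt (μ M) (X M) (3 * (M : ℝ) / 2 - 1) (ε + η)) / M) :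
    ∃ s : ℝ → ℝ, ContinuousOn s (Ioi e₀) ∧ StrictMonoOn s (Ioi e₀) ∧
      ∀ ε > e₀, Tendsto
        (fun N : ℕ => Real.log (truncPowInt (μ N) (X N) (3 * (N : ℝ) / 2 - 1) ε) / N)
        atTop (nhds (s ε)) := by
  have ha : ∀ N : ℕ, 0 < N → 0 ≤ 3 * (N : ℝ) / 2 - 1 := by
    intro N hN
    have : (1 : ℝ) ≤ N := by exact_mod_cast hN
    linarith
  refine exists_limit_of_almost_superadditive he₀ hsup ?_ ?_ ?_
  · intro ε hε
    refine ⟨Real.log v + 3 / 2 * |Real.log ε|, ?_⟩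
    filter_upwards [eventually_gt_atTop 0] with N hN
    have hN' : (1 : ℝ) ≤ N := by exact_mod_cast hN
    have hε0 : 0 < ε := by linarith
    have h := Real.log_le_log (hpos ε hε N hN)
      (truncPowInt_le (hX N) (hX0 N) (ha N hN) hε0.le)
    rw [hμ, Real.log_mul (by positivity) (Real.rpow_pos_of_pos hε0 _).ne', Real.log_pow,
      Real.log_rpow hε0] at h
    rw [div_le_iff₀ (by linarith)]
    have h3 := mul_le_mul_of_nonneg_left (le_abs_self (Real.log ε)) (ha N hN)
    have h4 := abs_nonneg (Real.log ε)
    linarith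
  · intro ε ε' h1 h2
    filter_upwards [eventually_gt_atTop 0] with N hN
    have hN' : (0 : ℝ) < N := by exact_mod_cast hN
    have hε0 : 0 < ε := by linarith
    have hr : 0 < ε' / ε := div_pos (by linarith) hε0
    have h := Real.log_le_log (mul_pos (Real.rpow_pos_of_pos hr _) (hpos ε h1 N hN))
      (rpow_mul_truncPowInt_le (hX N) (hX0 N) (ha N hN) hε0 h2.le)
    rw [Real.log_mul (Real.rpow_pos_of_pos hr _).ne' (hpos ε h1 N hN).ne', Real.log_rpow hr] at h
    have h' := div_le_div_of_nonneg_right h hN'.le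
    refine le_trans (le_of_eq ?_) h'
    field_simp
    ring
  · intro ε₀ h₀
    obtain ⟨e₁, h₁, h₂⟩ := exists_between h₀
    have hB := hsup e₁ h₁ (ε₀ - e₁) (by linarith) 1 one_pos
    obtain ⟨N₀, hN₀⟩ := hB.exists
    rw [add_sub_cancel] at hN₀
    set c := Real.log (truncPowInt (μ N₀) (X N₀) (3 * (N₀ : ℝ) / 2 - 1) e₁) / N₀ - 1
    refine ⟨min 1 (Real.exp c / (2 * v)), by positivity, ?_⟩
    set δ₀ := min 1 (Real.exp c / (2 * v)) with hδ₀def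
    have hδ₀ : 0 < δ₀ := by positivity
    filter_upwards [hN₀, eventually_ge_atTop 2] with N hNc hN2
    intro ε ε' hε hεε' hε'
    have hN2' : (2 : ℝ) ≤ N := by exact_mod_cast hN2
    have haN := ha N (by omega)
    have hZ := hpos ε (by linarith) N (by omega)
    have hZ' := hpos ε' (by linarith) N (by omega)
    have hZ₀ := hpos ε₀ h₀ N (by omega)
    have hmain := truncPowInt_le_add (hX N) (hX0 N) haN hδ₀ hεε'.le hε'
    have hθ : 0 < 1 - (ε' - ε) / δ₀ := by
      rw [sub_pos, div_lt_one hδ₀]; linarith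
    have hθ1 : 1 - (ε' - ε) / δ₀ ≤ 1 := by
      have : 0 ≤ (ε' - ε) / δ₀ := div_nonneg (by linarith) hδ₀.le
      linarith
    have hlow : Real.exp c ^ N ≤ truncPowInt (μ N) (X N) (3 * (N : ℝ) / 2 - 1) ε' := by
      refine le_trans ?_ (truncPowInt_mono (hX N) (hX0 N) haN (hε.trans hεε'.le))
      rw [← Real.exp_nat_mul, ← Real.le_log_iff_exp_le hZ₀, mul_comm]
      exact (le_div_iff₀ (by linarith)).1 hNc
    have hsmall : (μ N).real univ * δ₀ ^ (3 * (N : ℝ) / 2 - 1) ≤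
        truncPowInt (μ N) (X N) (3 * (N : ℝ) / 2 - 1) ε' / 2 := by
      have e1 : δ₀ ^ (3 * (N : ℝ) / 2 - 1) ≤ δ₀ ^ N := by
        rw [← Real.rpow_natCast]
        exact Real.rpow_le_rpow_of_exponent_ge hδ₀ (min_le_left _ _) (by linarith)
      have e2 : v * δ₀ ≤ Real.exp c / 2 := by
        have : δ₀ ≤ Real.exp c / (2 * v) := min_le_right _ _
        rw [le_div_iff₀ (by positivity)] at this
        linarith
      have e3 : (v * δ₀) ^ N ≤ Real.exp c ^ N / 2 := by
        refine (pow_le_pow_left₀ (by positivity) e2 N).trans ?_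
        rw [div_pow]
        refine div_le_div_of_nonneg_left (by positivity) (by norm_num) ?_
        calc (2 : ℝ) = 2 ^ 1 := by norm_num
          _ ≤ 2 ^ N := pow_le_pow_right₀ (by norm_num) (by omega)
      rw [hμ]
      calc v ^ N * δ₀ ^ (3 * (N : ℝ) / 2 - 1) ≤ v ^ N * δ₀ ^ N := by gcongr
        _ = (v * δ₀) ^ N := (mul_pow _ _ _).symm
        _ ≤ _ := by linarith
    have hθa := Real.rpow_pos_of_pos hθ (3 * (N : ℝ) / 2 - 1)
    have hfin : truncPowInt (μ N) (X N) (3 * (N : ℝ) / 2 - 1) ε' ≤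
        2 * (((1 - (ε' - ε) / δ₀) ^ (3 * (N : ℝ) / 2 - 1))⁻¹ *
          truncPowInt (μ N) (X N) (3 * (N : ℝ) / 2 - 1) ε) := by linarith
    have hl := Real.log_le_log hZ' hfin
    rw [Real.log_mul (by norm_num) (by positivity), Real.log_mul (by positivity) hZ.ne',
      Real.log_inv, Real.log_rpow hθ] at hl
    have hlθ : Real.log (1 - (ε' - ε) / δ₀) ≤ 0 := Real.log_nonpos hθ.le hθ1
    have hNp : (0 : ℝ) < N := by linarith
    rw [div_le_iff₀ hNp]
    have : (Real.log (truncPowInt (μ N) (X N) (3 * (N : ℝ) / 2 - 1) ε) / N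
        - 3 / 2 * Real.log (1 - (ε' - ε) / δ₀) + Real.log 2 / N) * N =
        Real.log (truncPowInt (μ N) (X N) (3 * (N : ℝ) / 2 - 1) ε)
        - 3 / 2 * Real.log (1 - (ε' - ε) / δ₀) * N + Real.log 2 := by
      field_simp
    rw [this]
    linarith

/-! ### Words over a finite alphabet and their types -/

section Words

variable {κ : Type*}

section

variable [DecidableEq κ]

/-- The number of occurrences of each letter in a word. -/
def wordType {n : ℕ} (σ : Fin n → κ) (a : κ) : ℕ := ∑ i, if σ i = a then 1 else 0

theorem wordType_append {n m : ℕ} (σ : Fin n → κ) (τ : Fin m → κ) :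
    wordType (Fin.append σ τ) = wordType σ + wordType τ := by
  ext a
  simp only [wordType, Fin.sum_univ_add, Fin.append_left, Fin.append_right, Pi.add_apply]

theorem wordType_le {n : ℕ} (σ : Fin n → κ) (a : κ) : wordType σ a ≤ n := by
  calc wordType σ a ≤ ∑ _i : Fin n, 1 := Finset.sum_le_sum fun i _ => by split_ifs <;> simp
    _ = n := by simp

end

variable [Fintype κ]

/-- The quadratic form `∑ t_a t_b V(a,b)`. -/
def quadForm (V : κ → κ → ℝ) (t : κ → ℕ) : ℝ := ∑ a, ∑ b, (t a : ℝ) * t b * V a b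

/-- The quadratic form of `m` copies of a word of length `n` followed by one of length `r`. -/
theorem quadForm_nsmul_add_le {V : κ → κ → ℝ} {B : ℝ} (hVB : ∀ a b, V a b ≤ B)
    {n m r : ℕ} {t s : κ → ℕ} (ht : ∑ a, t a = n) (hs : ∑ a, s a = r) :
    quadForm V (m • t + s) ≤ (m : ℝ) ^ 2 * quadForm V t + B * (2 * m * n * r + r ^ 2) := by
  have ht' : ∑ a, (t a : ℝ) = n := by exact_mod_cast ht
  have hs' : ∑ a, (s a : ℝ) = r := by exact_mod_cast hs
  have h1 : quadForm V (m • t + s) - (m : ℝ) ^ 2 * quadForm V t =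
      ∑ a, ∑ b, ((m : ℝ) * t a * s b + m * s a * t b + s a * s b) * V a b := by
    rw [quadForm, quadForm, Finset.mul_sum, ← Finset.sum_sub_distrib]
    refine Finset.sum_congr rfl fun a _ => ?_
    rw [Finset.mul_sum, ← Finset.sum_sub_distrib]
    refine Finset.sum_congr rfl fun b _ => ?_
    simp only [Pi.add_apply, Pi.smul_apply, smul_eq_mul]
    push_cast
    ring
  have h2 : ∑ a, ∑ b, ((m : ℝ) * t a * s b + m * s a * t b + s a * s b) * V a b ≤
      ∑ a, ∑ b, ((m : ℝ) * t a * s b + m * s a * t b + s a * s b) * B :=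
    Finset.sum_le_sum fun a _ => Finset.sum_le_sum fun b _ =>
      mul_le_mul_of_nonneg_left (hVB a b) (by positivity)
  have h3 : ∑ a, ∑ b, ((m : ℝ) * t a * s b + m * s a * t b + s a * s b) * B =
      B * (2 * m * n * r + r ^ 2) := by
    have e1 : ∀ x y : κ → ℝ, ∑ a, ∑ b, x a * y b = (∑ a, x a) * ∑ b, y b := by
      intro x y
      rw [Finset.sum_mul_sum]
    simp only [← Finset.sum_mul, Finset.sum_add_distrib, mul_assoc, ← Finset.mul_sum, ht', hs']
    ring
  linarith

variable [DecidableEq κ]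

/-- The total weight of the words of length `n` with occurrence numbers `t`. -/
def typeWeight (p : κ → ℝ) (n : ℕ) (t : κ → ℕ) : ℝ :=
  ∑ σ : Fin n → κ with wordType σ = t, ∏ i, p (σ i)

theorem sum_word_eq_sum_type {n : ℕ} (σ : Fin n → κ) (g : κ → ℝ) :
    ∑ i, g (σ i) = ∑ a, (wordType σ a : ℝ) * g a := by
  simp only [wordType, Nat.cast_sum, Finset.sum_mul]
  rw [Finset.sum_comm]
  simp

theorem typeWeight_nonneg {p : κ → ℝ} (hp : ∀ a, 0 ≤ p a) (n : ℕ) (t : κ → ℕ) :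
    0 ≤ typeWeight p n t :=
  Finset.sum_nonneg fun _ _ => Finset.prod_nonneg fun _ _ => hp _

theorem typeWeight_mul_le {p : κ → ℝ} (hp : ∀ a, 0 ≤ p a) (n m : ℕ) (t s : κ → ℕ) :
    typeWeight p n t * typeWeight p m s ≤ typeWeight p (n + m) (t + s) := by
  rw [typeWeight, typeWeight, Finset.sum_mul_sum, ← Finset.sum_product']
  have hinj : Set.InjOn (Fin.appendEquiv (α := κ) n m)
      (((Finset.univ.filter fun σ : Fin n → κ => wordType σ = t) ×ˢ
        (Finset.univ.filter fun σ : Fin m → κ => wordType σ = s) :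
        Finset ((Fin n → κ) × (Fin m → κ))) : Set ((Fin n → κ) × (Fin m → κ))) :=
    (Fin.appendEquiv (α := κ) n m).injective.injOn
  have : ∀ x : (Fin n → κ) × (Fin m → κ), (∏ i, p (x.1 i)) * ∏ i, p (x.2 i) =
      ∏ i, p (Fin.appendEquiv (α := κ) n m x i) := by
    intro x
    simp [Fin.appendEquiv, Fin.prod_univ_add]
  simp_rw [this]
  rw [← Finset.sum_image (f := fun σ : Fin (n + m) → κ => ∏ i, p (σ i)) hinj, typeWeight]
  refine Finset.sum_le_sum_of_subset_of_nonneg ?_ fun _ _ _ => Finset.prod_nonneg fun _ _ => hp _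
  intro σ hσ
  simp only [Finset.mem_image, Finset.mem_product, Finset.mem_filter, Finset.mem_univ,
    true_and] at hσ ⊢
  obtain ⟨⟨x, y⟩, ⟨hx, hy⟩, rfl⟩ := hσ
  simp only [Fin.appendEquiv, Equiv.coe_fn_mk] at hx hy ⊢
  rw [wordType_append, hx, hy]

theorem pow_typeWeight_le {p : κ → ℝ} (hp : ∀ a, 0 ≤ p a) (n : ℕ) (t : κ → ℕ) (m : ℕ) :
    typeWeight p n t ^ m ≤ typeWeight p (m * n) (m • t) := by
  induction m with
  | zero =>
    rw [zero_mul, zero_smul, pow_zero, typeWeight]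
    have : (1 : ℝ) = ∏ i : Fin 0, p ((Fin.elim0 : Fin 0 → κ) i) := by simp
    rw [this]
    refine Finset.single_le_sum (f := fun σ : Fin 0 → κ => ∏ i, p (σ i))
      (fun _ _ => Finset.prod_nonneg fun _ _ => hp _) ?_
    simp only [Finset.mem_filter, Finset.mem_univ, true_and]
    ext a
    simp [wordType]
  | succ m ih =>
    rw [pow_succ, succ_nsmul, add_mul, one_mul]
    exact (mul_le_mul_of_nonneg_right ih (typeWeight_nonneg hp _ _)).trans
      (typeWeight_mul_le hp _ _ _ _)

theorem pow_le_typeWeight {p : κ → ℝ} (hp : ∀ a, 0 ≤ p a) (a : κ) (r : ℕ) :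
    p a ^ r ≤ typeWeight p r (wordType fun _ : Fin r => a) := by
  have : p a ^ r = ∏ i : Fin r, p ((fun _ => a : Fin r → κ) i) := by simp
  rw [this]
  exact Finset.single_le_sum (f := fun σ : Fin r → κ => ∏ i, p (σ i))
    (fun _ _ => Finset.prod_nonneg fun _ _ => hp _) (by simp)

/-- Pigeonhole over the polynomially many types of words of length `n`. -/
theorem exists_type_sum_le (p : κ → ℝ) (n : ℕ) (H : (κ → ℕ) → ℝ) :
    ∃ t : κ → ℕ, ∑ σ : Fin n → κ, (∏ i, p (σ i)) * H (wordType σ) ≤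
      ((n : ℝ) + 1) ^ Fintype.card κ * (typeWeight p n t * H t) := by
  classical
  set T : Finset (κ → ℕ) := Fintype.piFinset fun _ => Finset.range (n + 1) with hT
  have hmaps : ∀ σ ∈ (Finset.univ : Finset (Fin n → κ)), wordType σ ∈ T := by
    intro σ _
    rw [hT, Fintype.mem_piFinset]
    exact fun a => Finset.mem_range.2 (Nat.lt_succ_of_le (wordType_le σ a))
  have hTne : T.Nonempty := ⟨fun _ => 0, by simp [hT]⟩
  obtain ⟨t, -, ht⟩ := T.exists_max_image (fun t => typeWeight p n t * H t) hTne
  refine ⟨t, ?_⟩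
  rw [← Finset.sum_fiberwise_of_maps_to hmaps]
  have hcard : (T.card : ℝ) = ((n : ℝ) + 1) ^ Fintype.card κ := by
    rw [hT, Fintype.card_piFinset]
    simp
  rw [← hcard, ← nsmul_eq_mul]
  refine Finset.sum_le_card_nsmul _ _ _ fun s hs => ?_
  refine le_trans (le_of_eq ?_) (ht s hs)
  rw [typeWeight, Finset.sum_mul]
  refine Finset.sum_congr rfl fun σ hσ => ?_
  rw [(Finset.mem_filter.1 hσ).2]

theorem sum_sum_word {n : ℕ} (V : κ → κ → ℝ) (σ : Fin n → κ) :
    ∑ i, ∑ j, V (σ i) (σ j) = quadForm V (wordType σ) := by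
  rw [sum_word_eq_sum_type σ fun a => ∑ j, V a (σ j), quadForm]
  refine Finset.sum_congr rfl fun a _ => ?_
  rw [sum_word_eq_sum_type σ (V a), Finset.mul_sum]
  exact Finset.sum_congr rfl fun b _ => by ring

theorem sum_wordType {n : ℕ} (σ : Fin n → κ) : ∑ a, wordType σ a = n := by
  simp only [wordType]
  rw [Finset.sum_comm]
  simp

theorem exists_word_of_typeWeight_pos {p : κ → ℝ} {n : ℕ} {t : κ → ℕ}
    (h : 0 < typeWeight p n t) : ∃ σ : Fin n → κ, wordType σ = t ∧ ∀ i, p (σ i) ≠ 0 := by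
  obtain ⟨σ, hσ, hne⟩ := Finset.exists_ne_zero_of_sum_ne_zero (ne_of_gt h)
  exact ⟨σ, (Finset.mem_filter.1 hσ).2, fun i => Finset.prod_ne_zero_iff.1 hne i (Finset.mem_univ i)⟩

end Words

/-! ### Discretization of the interaction -/

theorem two_mul_interaction {U : Euc → Euc → ℝ} (hsymm : ∀ x y, U x y = U y x) (N : ℕ)
    (q : Fin N → Euc) :
    2 * interaction U N q = ∑ i, ∑ j, U (q i) (q j) - ∑ i, U (q i) (q i) := by
  have h1 : interaction U N q =
      ∑ i : Fin N, ∑ j : Fin N, if (j : ℕ) < (i : ℕ) then U (q i) (q j) else 0 := by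
    rw [interaction, Finset.sum_comm]
    simp only [hsymm]
  have h2 : ∑ i, U (q i) (q i) = ∑ i : Fin N, ∑ j : Fin N, if i = j then U (q i) (q j) else 0 := by
    simp
  rw [two_mul, h2]
  nth_rewrite 2 [h1]
  rw [interaction, eq_sub_iff_add_eq, ← Finset.sum_add_distrib, ← Finset.sum_add_distrib]
  refine Finset.sum_congr rfl fun i _ => ?_
  rw [← Finset.sum_add_distrib, ← Finset.sum_add_distrib]
  refine Finset.sum_congr rfl fun j _ => ?_
  rcases lt_trichotomy i j with h | rfl | h
  · simp [h, h.ne, not_lt.2 h.le]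
  · simp
  · simp [h, h.ne', not_lt.2 h.le]

theorem interaction_nonneg {U : Euc → Euc → ℝ} (h0 : ∀ x y, 0 ≤ U x y) (N : ℕ)
    (q : Fin N → Euc) : 0 ≤ interaction U N q :=
  Finset.sum_nonneg fun _ _ => Finset.sum_nonneg fun _ _ => by split_ifs <;> simp [h0]

theorem continuous_interaction {U : Euc → Euc → ℝ}
    (hU : Continuous fun p : Euc × Euc => U p.1 p.2) (N : ℕ) :
    Continuous (interaction U N) := by
  unfold interaction
  refine continuous_finsetSum _ fun i _ => continuous_finsetSum _ fun j _ => ?_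
  split_ifs
  · exact hU.comp (g := fun p : Euc × Euc => U p.1 p.2) (f := fun q : Fin N → Euc => (q i, q j))
      (by fun_prop)
  · exact continuous_const

theorem exists_discretization {U : Euc → Euc → ℝ}
    (hU : Continuous fun p : Euc × Euc => U p.1 p.2) {B : ℝ} (h0 : ∀ x y, 0 ≤ U x y)
    (hB : ∀ x y, U x y ≤ B) {Λ : Set Euc} (hne : Λ.Nonempty) (hbdd : Bornology.IsBounded Λ)
    {η : ℝ} (hη : 0 < η) :
    ∃ (k : ℕ) (c : Euc → Fin k) (V : Fin k → Fin k → ℝ), Measurable c ∧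
      (∀ a b, 0 ≤ V a b) ∧ (∀ a b, V a b ≤ B) ∧
      ∀ x ∈ Λ, ∀ y ∈ Λ, |U x y - V (c x) (c y)| ≤ η := by
  have hK : IsCompact (closure Λ) := hbdd.isCompact_closure
  have huc : UniformContinuousOn (fun p : Euc × Euc => U p.1 p.2) (closure Λ ×ˢ closure Λ) :=
    (hK.prod hK).uniformContinuousOn_of_continuous hU.continuousOn
  obtain ⟨δ, hδ, huc⟩ := Metric.uniformContinuousOn_iff.1 huc η hη
  obtain ⟨x₀, hx₀⟩ := hne
  obtain ⟨T, hTsub, hTfin, hTcov⟩ := hK.finite_cover_balls hδ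
  have hTne : T.Nonempty := by
    by_contra h
    rw [Set.not_nonempty_iff_eq_empty] at h
    have := hTcov (subset_closure hx₀)
    simp [h] at this
  obtain ⟨e, he⟩ := hTfin.countable.exists_eq_range hTne
  obtain ⟨n, hn⟩ : ∃ n : ℕ, ∀ y ∈ T, ∃ i ≤ n, e i = y := by
    have : ∀ y : Euc, ∃ i : ℕ, y ∈ T → e i = y := by
      intro y
      by_cases hy : y ∈ T
      · obtain ⟨i, hi⟩ := he ▸ hy
        exact ⟨i, fun _ => hi⟩
      · exact ⟨0, fun h => absurd h hy⟩
    choose g hg using this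
    refine ⟨hTfin.toFinset.sup g, fun y hy => ⟨g y, ?_, hg y hy⟩⟩
    exact Finset.le_sup (hTfin.mem_toFinset.2 hy)
  refine ⟨n + 1, fun x => ⟨SimpleFunc.nearestPtInd e n x,
    Nat.lt_succ_of_le (SimpleFunc.nearestPtInd_le e n x)⟩, fun a b => U (e a) (e b), ?_,
    fun _ _ => h0 _ _, fun _ _ => hB _ _, ?_⟩
  · refine measurable_to_countable' fun b => ?_
    convert (SimpleFunc.nearestPtInd e n).measurableSet_fiber (b : ℕ) using 1
    ext x
    simp [Fin.ext_iff]
  · have hnear : ∀ x ∈ Λ, dist x (e (SimpleFunc.nearestPtInd e n x)) < δ := by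
      intro x hx
      obtain ⟨y, hy, hxy⟩ := Set.mem_iUnion₂.1 (hTcov (subset_closure hx))
      obtain ⟨i, hi, rfl⟩ := hn y hy
      have h1 := SimpleFunc.edist_nearestPt_le e x hi
      have h2 : edist ((SimpleFunc.nearestPt e n) x) x < ENNReal.ofReal δ := by
        refine h1.trans_lt ?_
        rw [edist_comm, edist_lt_ofReal]
        exact hxy
      rw [edist_lt_ofReal, dist_comm] at h2
      exact h2
    have hmem : ∀ i, e i ∈ closure Λ := fun i => hTsub (he ▸ mem_range_self i)
    intro x hx y hy
    have := huc (x, y) ⟨subset_closure hx, subset_closure hy⟩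
      (e (SimpleFunc.nearestPtInd e n x), e (SimpleFunc.nearestPtInd e n y)) ⟨hmem _, hmem _⟩
      (by rw [Prod.dist_eq]; exact max_lt (hnear x hx) (hnear y hy))
    rw [Real.dist_eq] at this
    exact this.le

theorem quadForm_nonneg {κ : Type*} [Fintype κ] {V : κ → κ → ℝ} (hV : ∀ a b, 0 ≤ V a b)
    (t : κ → ℕ) : 0 ≤ quadForm V t :=
  Finset.sum_nonneg fun a _ => Finset.sum_nonneg fun b _ => mul_nonneg (by positivity) (hV a b)

theorem abs_sum_sub_quadForm_le {U : Euc → Euc → ℝ} {Λ : Set Euc} {k : ℕ} {c : Euc → Fin k}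
    {V : Fin k → Fin k → ℝ} {η : ℝ} (hV : ∀ x ∈ Λ, ∀ y ∈ Λ, |U x y - V (c x) (c y)| ≤ η)
    {N : ℕ} {q : Fin N → Euc} (hq : ∀ i, q i ∈ Λ) :
    |∑ i, ∑ j, U (q i) (q j) - quadForm V (wordType fun i => c (q i))| ≤ N ^ 2 * η := by
  rw [← sum_sum_word, ← Finset.sum_sub_distrib]
  simp_rw [← Finset.sum_sub_distrib]
  calc |∑ i, ∑ j, (U (q i) (q j) - V (c (q i)) (c (q j)))|
      ≤ ∑ i, ∑ j, |U (q i) (q j) - V (c (q i)) (c (q j))| :=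
        (Finset.abs_sum_le_sum_abs _ _).trans
          (Finset.sum_le_sum fun i _ => Finset.abs_sum_le_sum_abs _ _)
    _ ≤ ∑ _i : Fin N, ∑ _j : Fin N, η :=
        Finset.sum_le_sum fun i _ => Finset.sum_le_sum fun j _ => hV _ (hq i) _ (hq j)
    _ = N ^ 2 * η := by simp; ring

theorem integral_pi_comp {ν : Measure Euc} [IsFiniteMeasure ν] {k : ℕ} {c : Euc → Fin k}
    (hc : Measurable c) (N : ℕ) (H : (Fin N → Fin k) → ℝ) :
    ∫ q : Fin N → Euc, H (fun i => c (q i)) ∂(Measure.pi fun _ => ν) =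
      ∑ σ : Fin N → Fin k, (∏ i, ν.real (c ⁻¹' {σ i})) * H σ := by
  have hm : Measurable fun (q : Fin N → Euc) i => c (q i) :=
    measurable_pi_lambda _ fun i => hc.comp (measurable_pi_apply i)
  rw [← integral_map (f := H) hm.aemeasurable (measurable_of_finite H).aestronglyMeasurable,
    Measure.pi_map_pi (μ := fun _ : Fin N => ν) (f := fun _ => c) fun _ => hc.aemeasurable,
    integral_fintype (Integrable.of_finite)]
  refine Finset.sum_congr rfl fun σ _ => ?_
  rw [smul_eq_mul, measureReal_def, Measure.pi_singleton, ENNReal.toReal_prod]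
  congr 1
  refine Finset.prod_congr rfl fun i _ => ?_
  rw [Measure.map_apply hc (measurableSet_singleton _), measureReal_def]

/-! ### The thermodynamic limit for a globally continuous interaction -/

/-- Lebesgue measure restricted to `Λ ^ N`. -/
def configMeasure (Λ : Set Euc) (N : ℕ) : Measure (Fin N → Euc) :=
  Measure.pi fun _ => (volume : Measure Euc).restrict Λ

/-- The interaction energy in units of `N ^ 2`. -/
def scaledInteraction (U : Euc → Euc → ℝ) (N : ℕ) (q : Fin N → Euc) : ℝ :=
  interaction U N q / (N : ℝ) ^ 2

/-- The configurational integral `∫ (ε - I_N / N²)₊ ^ (3N/2 - 1)` over `Λ ^ N`. -/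
def configInt (U : Euc → Euc → ℝ) (Λ : Set Euc) (N : ℕ) (ε : ℝ) : ℝ :=
  truncPowInt (configMeasure Λ N) (scaledInteraction U N) (3 * (N : ℝ) / 2 - 1) ε

theorem configMeasure_eq (Λ : Set Euc) (N : ℕ) :
    configMeasure Λ N = volume.restrict (Set.univ.pi fun _ => Λ) :=
  (Measure.restrict_pi_pi (fun _ => (volume : Measure Euc)) fun _ => Λ).symm

theorem ae_mem_configMeasure {Λ : Set Euc} (hΛ : MeasurableSet Λ) (N : ℕ) :
    ∀ᵐ q ∂(configMeasure Λ N), ∀ i, q i ∈ Λ := by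
  rw [configMeasure_eq]
  filter_upwards [ae_restrict_mem (MeasurableSet.univ_pi fun _ => hΛ)] with q hq i
  exact hq i (Set.mem_univ i)

theorem three_halves_sub_one_pos {N : ℕ} (hN : 0 < N) : 0 < 3 * (N : ℝ) / 2 - 1 := by
  have : (1 : ℝ) ≤ N := by exact_mod_cast hN
  linarith

section Discretized

variable {U : Euc → Euc → ℝ} {Λ : Set Euc} {B η ε Y : ℝ} {k : ℕ} {c : Euc → Fin k}
  {V : Fin k → Fin k → ℝ} [IsFiniteMeasure ((volume : Measure Euc).restrict Λ)]

theorem integrable_configInt (hU : Continuous fun p : Euc × Euc => U p.1 p.2)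
    (h0 : ∀ x y, 0 ≤ U x y) {N : ℕ} (hN : 0 < N) (ε : ℝ) :
    Integrable (fun q => (max (ε - scaledInteraction U N q) 0) ^ (3 * (N : ℝ) / 2 - 1))
      (configMeasure Λ N) := by
  have : IsFiniteMeasure (configMeasure Λ N) := by unfold configMeasure; infer_instance
  refine integrable_truncPow ?_ ?_ (three_halves_sub_one_pos hN).le
  · exact ((continuous_interaction hU N).div_const _).measurable.aemeasurable
  · exact Eventually.of_forall fun q => div_nonneg (interaction_nonneg h0 N q) (by positivity)

theorem integrable_comp_cells (hc : Measurable c) (N : ℕ) (H : (Fin N → Fin k) → ℝ) :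
    Integrable (fun q : Fin N → Euc => H fun i => c (q i)) (configMeasure Λ N) := by
  have : IsFiniteMeasure (configMeasure Λ N) := by unfold configMeasure; infer_instance
  have hm : Measurable fun (q : Fin N → Euc) i => c (q i) :=
    measurable_pi_lambda _ fun i => hc.comp (measurable_pi_apply i)
  obtain ⟨C, hC⟩ : ∃ C, ∀ σ, ‖H σ‖ ≤ C := by
    refine ⟨∑ σ, ‖H σ‖, fun σ => ?_⟩
    exact Finset.single_le_sum (f := fun σ => ‖H σ‖) (fun _ _ => norm_nonneg _)
      (Finset.mem_univ σ)
  exact Integrable.of_bound ((measurable_of_finite H).comp hm).aestronglyMeasurable C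
    (Eventually.of_forall fun q => hC _)

theorem exists_type_of_configInt_pos (hU : Continuous fun p : Euc × Euc => U p.1 p.2)
    (hsymm : ∀ x y, U x y = U y x) (h0 : ∀ x y, 0 ≤ U x y) (hB : ∀ x y, U x y ≤ B)
    (hΛ : MeasurableSet Λ) (hc : Measurable c)
    (hV : ∀ x ∈ Λ, ∀ y ∈ Λ, |U x y - V (c x) (c y)| ≤ η) (hη : 0 ≤ η)
    {N : ℕ} (hN : 0 < N) (hNη : B ≤ N * η) (hpos : 0 < configInt U Λ N ε) :
    ∃ t : Fin k → ℕ,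
      0 < typeWeight (fun a => (volume.restrict Λ).real (c ⁻¹' {a})) N t ∧
      η < ε + 2 * η - quadForm V t / (2 * (N : ℝ) ^ 2) ∧
      configInt U Λ N ε ≤ ((N : ℝ) + 1) ^ k *
        (typeWeight (fun a => (volume.restrict Λ).real (c ⁻¹' {a})) N t *
          (ε + 2 * η - quadForm V t / (2 * (N : ℝ) ^ 2)) ^ (3 * (N : ℝ) / 2 - 1)) := by
  have ha := three_halves_sub_one_pos hN
  have hN' : (0 : ℝ) < N := by exact_mod_cast hN
  set p : Fin k → ℝ := fun a => (volume.restrict Λ).real (c ⁻¹' {a}) with hp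
  have hp0 : ∀ a, 0 ≤ p a := fun a => measureReal_nonneg
  set H : (Fin k → ℕ) → ℝ := fun t =>
    (max (ε + η - quadForm V t / (2 * (N : ℝ) ^ 2)) 0) ^ (3 * (N : ℝ) / 2 - 1) with hH
  obtain ⟨t, ht⟩ := exists_type_sum_le p N H
  have hle : configInt U Λ N ε ≤ ((N : ℝ) + 1) ^ k * (typeWeight p N t * H t) := by
    rw [Fintype.card_fin] at ht
    refine le_trans ?_ ht
    rw [← integral_pi_comp hc N (fun σ => H (wordType σ))]
    refine integral_mono_ae (integrable_configInt hU h0 hN ε)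
      (integrable_comp_cells hc N fun σ => H (wordType σ)) ?_
    filter_upwards [ae_mem_configMeasure hΛ N] with q hq
    refine Real.rpow_le_rpow (le_max_right _ _) (max_le_max ?_ le_rfl) ha.le
    have h1 := (abs_le.1 (abs_sum_sub_quadForm_le hV hq)).1
    have h2 := two_mul_interaction hsymm N q
    have h3 : ∑ i, U (q i) (q i) ≤ N * B := by
      calc ∑ i, U (q i) (q i) ≤ ∑ _i : Fin N, B := Finset.sum_le_sum fun i _ => hB _ _
        _ = N * B := by simp
    have h4 : (N : ℝ) * B ≤ N ^ 2 * η := by nlinarith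
    have h5 : quadForm V (wordType fun i => c (q i)) / (2 * (N : ℝ) ^ 2) - η ≤
        scaledInteraction U N q := by
      rw [scaledInteraction, sub_le_iff_le_add, div_le_iff₀ (by positivity)]
      have : (interaction U N q / (N : ℝ) ^ 2 + η) * (2 * (N : ℝ) ^ 2) =
          2 * interaction U N q + 2 * (N ^ 2 * η) := by
        field_simp
      rw [this]
      linarith
    linarith
  have hWH : 0 < typeWeight p N t * H t := by
    by_contra hneg
    have : ((N : ℝ) + 1) ^ k * (typeWeight p N t * H t) ≤ 0 :=
      mul_nonpos_of_nonneg_of_nonpos (by positivity) (not_lt.1 hneg)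
    linarith
  have hH0 : 0 ≤ H t := Real.rpow_nonneg (le_max_right _ _) _
  have hW0 := typeWeight_nonneg hp0 N t
  have hW : 0 < typeWeight p N t := lt_of_le_of_ne hW0 fun h => by simp [← h] at hWH
  have hX : 0 < ε + η - quadForm V t / (2 * (N : ℝ) ^ 2) := by
    by_contra hneg
    have : H t = 0 := by
      simp only [hH]
      rw [max_eq_right (not_lt.1 hneg), Real.zero_rpow ha.ne']
    simp [this] at hWH
  refine ⟨t, hW, by linarith, hle.trans ?_⟩
  have : H t ≤ (ε + 2 * η - quadForm V t / (2 * (N : ℝ) ^ 2)) ^ (3 * (N : ℝ) / 2 - 1) := by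
    simp only [hH]
    rw [max_eq_left hX.le]
    exact Real.rpow_le_rpow hX.le (by linarith) ha.le
  gcongr

theorem typeWeight_mul_rpow_le_configInt (hU : Continuous fun p : Euc × Euc => U p.1 p.2)
    (hsymm : ∀ x y, U x y = U y x) (h0 : ∀ x y, 0 ≤ U x y)
    (hΛ : MeasurableSet Λ) (hc : Measurable c)
    (hV : ∀ x ∈ Λ, ∀ y ∈ Λ, |U x y - V (c x) (c y)| ≤ η)
    {M : ℕ} (hM : 0 < M) (t : Fin k → ℕ) (hY : 0 ≤ Y)
    (hYε : Y ≤ ε - η / 2 - quadForm V t / (2 * (M : ℝ) ^ 2)) :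
    typeWeight (fun a => (volume.restrict Λ).real (c ⁻¹' {a})) M t *
      Y ^ (3 * (M : ℝ) / 2 - 1) ≤ configInt U Λ M ε := by
  have ha := three_halves_sub_one_pos hM
  have hM' : (0 : ℝ) < M := by exact_mod_cast hM
  have h1 : typeWeight (fun a => (volume.restrict Λ).real (c ⁻¹' {a})) M t *
      Y ^ (3 * (M : ℝ) / 2 - 1) = ∑ σ : Fin M → Fin k,
        (∏ i, (volume.restrict Λ).real (c ⁻¹' {σ i})) *
          (if wordType σ = t then Y ^ (3 * (M : ℝ) / 2 - 1) else 0) := by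
    rw [typeWeight, Finset.sum_mul, Finset.sum_filter]
    exact Finset.sum_congr rfl fun σ _ => by split_ifs <;> simp
  rw [h1, ← integral_pi_comp hc M
    (fun σ => if wordType σ = t then Y ^ (3 * (M : ℝ) / 2 - 1) else 0)]
  refine integral_mono_ae (integrable_comp_cells hc M
    fun σ => if wordType σ = t then Y ^ (3 * (M : ℝ) / 2 - 1) else 0)
    (integrable_configInt hU h0 hM ε) ?_
  filter_upwards [ae_mem_configMeasure hΛ M] with q hq
  split_ifs with hqt
  · refine Real.rpow_le_rpow hY (le_trans ?_ (le_max_left _ _)) ha.le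
    have h1 := (abs_le.1 (abs_sum_sub_quadForm_le hV hq)).2
    have h2 := two_mul_interaction hsymm M q
    have h3 : 0 ≤ ∑ i, U (q i) (q i) := Finset.sum_nonneg fun i _ => h0 _ _
    rw [hqt] at h1
    have h5 : scaledInteraction U M q ≤ quadForm V t / (2 * (M : ℝ) ^ 2) + η / 2 := by
      rw [scaledInteraction, div_le_iff₀ (by positivity)]
      have : (quadForm V t / (2 * (M : ℝ) ^ 2) + η / 2) * (M : ℝ) ^ 2 =
          (quadForm V t + M ^ 2 * η) / 2 := by
        field_simp
      rw [this]
      linarith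
    linarith
  · exact Real.rpow_nonneg (le_max_right _ _) _

end Discretized

theorem tendsto_log_add_one_div_nat :
    Tendsto (fun N : ℕ => Real.log ((N : ℝ) + 1) / (N : ℝ)) atTop (nhds 0) := by
  have h2 : Tendsto (fun N : ℕ => Real.log 2 / (N : ℝ)) atTop (nhds 0) :=
    tendsto_const_div_atTop_nhds_zero_nat _
  have h := h2.add tendsto_log_div_nat
  rw [add_zero] at h
  refine squeeze_zero' (Eventually.of_forall fun N => ?_) ?_ h
  · exact div_nonneg (Real.log_nonneg (by linarith [(Nat.cast_nonneg N : (0 : ℝ) ≤ N)]))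
      (Nat.cast_nonneg N)
  · filter_upwards [eventually_gt_atTop 0] with N hN
    have hN' : (1 : ℝ) ≤ N := by exact_mod_cast hN
    rw [← add_div, ← Real.log_mul (by norm_num) (by linarith)]
    exact div_le_div_of_nonneg_right (Real.log_le_log (by linarith) (by linarith)) (by linarith)

/-- Packing many copies of an optimal type of `N`-particle configurations into a large system. -/
theorem eventually_log_configInt_le {U : Euc → Euc → ℝ} {Λ : Set Euc} {B ε η δ : ℝ}
    (hU : Continuous fun p : Euc × Euc => U p.1 p.2)
    (hsymm : ∀ x y, U x y = U y x) (h0 : ∀ x y, 0 ≤ U x y) (hB : ∀ x y, U x y ≤ B)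
    (hne : Λ.Nonempty) (hopen : IsOpen Λ) (hbdd : Bornology.IsBounded Λ)
    (hpos : ∀ N : ℕ, 0 < N → 0 < configInt U Λ N ε) (hη' : 0 < η) (hδ : 0 < δ) :
    ∀ᶠ N : ℕ in atTop, ∀ᶠ M : ℕ in atTop,
      Real.log (configInt U Λ N ε) / N - δ ≤ Real.log (configInt U Λ M (ε + η)) / M := by
  obtain ⟨θ, hθ, rfl⟩ : ∃ θ, 0 < θ ∧ η = 4 * θ := ⟨η / 4, by positivity, by ring⟩
  have hfin : IsFiniteMeasure ((volume : Measure Euc).restrict Λ) :=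
    ⟨by rw [Measure.restrict_apply_univ]; exact hbdd.measure_lt_top⟩
  have hB0 : 0 ≤ B := (h0 0 0).trans (hB 0 0)
  obtain ⟨k, c, V, hc, hV0, hVB, hV⟩ := exists_discretization hU h0 hB hne hbdd hθ
  set p : Fin k → ℝ := fun a => (volume.restrict Λ).real (c ⁻¹' {a}) with hp
  have hp0 : ∀ a, 0 ≤ p a := fun a => measureReal_nonneg
  have hsmall : Tendsto (fun N : ℕ => k * (Real.log ((N : ℝ) + 1) / (N : ℝ)) -
      Real.log θ / (N : ℝ)) atTop (nhds 0) := by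
    simpa using (tendsto_log_add_one_div_nat.const_mul (k : ℝ)).sub
      (tendsto_const_div_atTop_nhds_zero_nat (Real.log θ))
  filter_upwards [eventually_gt_atTop 0, hsmall.eventually (gt_mem_nhds (half_pos hδ)),
    eventually_ge_atTop ⌈B / θ⌉₊] with N hN hNδ hNB
  have hN' : (0 : ℝ) < N := by exact_mod_cast hN
  have hNη : B ≤ N * θ := by
    rw [← div_le_iff₀ hθ]
    exact Nat.ceil_le.1 hNB
  obtain ⟨t, hW, hY, hup⟩ :=
    exists_type_of_configInt_pos hU hsymm h0 hB hopen.measurableSet hc hV hθ.le hN hNη (hpos N hN)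
  set Y := ε + 2 * θ - quadForm V t / (2 * (N : ℝ) ^ 2) with hYdef
  set W := typeWeight p N t with hWdef
  have hY0 : 0 < Y := hθ.trans hY
  obtain ⟨σ, hσt, hσp⟩ := exists_word_of_typeWeight_pos hW
  set a₀ := σ ⟨0, hN⟩
  have hpa : 0 < p a₀ := lt_of_le_of_ne (hp0 _) (Ne.symm (hσp _))
  have htsum : ∑ a, t a = N := hσt ▸ sum_wordType σ
  have hupper : Real.log (configInt U Λ N ε) / N ≤ δ / 2 + Real.log W / N +
      3 / 2 * Real.log Y := by
    have h1 := Real.log_le_log (hpos N hN) hup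
    rw [Real.log_mul (by positivity) (by positivity), Real.log_mul hW.ne' (by positivity),
      Real.log_pow, Real.log_rpow hY0] at h1
    have h2 := div_le_div_of_nonneg_right h1 hN'.le
    have h3 := div_le_div_of_nonneg_right (Real.log_le_log hθ hY.le) hN'.le
    have h4 : (k * Real.log ((N : ℝ) + 1) + (Real.log W + (3 * (N : ℝ) / 2 - 1) * Real.log Y)) / N
        = k * (Real.log ((N : ℝ) + 1) / N) + Real.log W / N + 3 / 2 * Real.log Y
          - Real.log Y / N := by
      field_simp
      ring
    rw [h4] at h2
    linarith
  set K := |Real.log W| + N * |Real.log (p a₀)| + |Real.log Y| with hK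
  have hKlim : Tendsto (fun M : ℕ => K / (M : ℝ)) atTop (nhds 0) :=
    tendsto_const_div_atTop_nhds_zero_nat _
  filter_upwards [eventually_gt_atTop 0, hKlim.eventually (gt_mem_nhds (half_pos hδ)),
    eventually_ge_atTop ⌈3 * B * N / (2 * θ)⌉₊] with M hM hMδ hMB
  have hM' : (0 : ℝ) < M := by exact_mod_cast hM
  set m := M / N with hm
  set r := M % N with hr
  have hmr : m * N + r = M := Nat.div_add_mod' M N
  have hmr' : (m : ℝ) * N + r = M := by exact_mod_cast hmr
  have hrN : (r : ℝ) ≤ N := by exact_mod_cast (Nat.mod_lt M hN).le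
  have hrM : (r : ℝ) ≤ M := by exact_mod_cast Nat.mod_le M N
  have hmNM : (m : ℝ) * N ≤ M := by linarith [(Nat.cast_nonneg r : (0 : ℝ) ≤ r)]
  set t' : Fin k → ℕ := m • t + wordType fun _ : Fin r => a₀ with ht'
  have hWM : W ^ m * p a₀ ^ r ≤ typeWeight p M t' := by
    have h1 : W ^ m * p a₀ ^ r ≤ typeWeight p (m * N + r) t' :=
      (mul_le_mul (pow_typeWeight_le hp0 N t m) (pow_le_typeWeight hp0 a₀ r) (by positivity)
        (typeWeight_nonneg hp0 _ _)).trans (typeWeight_mul_le hp0 _ _ _ _)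
    rwa [hmr] at h1
  have hQ : quadForm V t' / (2 * (M : ℝ) ^ 2) ≤ quadForm V t / (2 * (N : ℝ) ^ 2) + θ := by
    have h1 := quadForm_nsmul_add_le (m := m) hVB htsum (sum_wordType fun _ : Fin r => a₀)
    have h2 := quadForm_nonneg hV0 t
    have h3 : (m : ℝ) ^ 2 * quadForm V t ≤ (M : ℝ) ^ 2 * (quadForm V t / (N : ℝ) ^ 2) := by
      rw [mul_div_assoc', le_div_iff₀ (by positivity)]
      have : ((m : ℝ) * N) ^ 2 ≤ (M : ℝ) ^ 2 := pow_le_pow_left₀ (by positivity) hmNM 2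
      nlinarith
    have h4 : 2 * (m : ℝ) * N * r + (r : ℝ) ^ 2 ≤ 3 * N * M := by
      have hr0 : (0 : ℝ) ≤ r := Nat.cast_nonneg r
      have e1 : (m : ℝ) * N * r ≤ M * N := mul_le_mul hmNM hrN hr0 hM'.le
      have e2 : (r : ℝ) * r ≤ N * M := mul_le_mul hrN hrM hr0 hN'.le
      nlinarith
    have h5 : 3 * B * N ≤ M * (2 * θ) := by
      rw [← div_le_iff₀ (by positivity)]
      exact Nat.ceil_le.1 hMB
    have h6 : B * (2 * (m : ℝ) * N * r + (r : ℝ) ^ 2) ≤ 2 * θ * (M : ℝ) ^ 2 :=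
      calc B * (2 * (m : ℝ) * N * r + (r : ℝ) ^ 2) ≤ B * (3 * N * M) := by gcongr
        _ = 3 * B * N * M := by ring
        _ ≤ M * (2 * θ) * M := by gcongr
        _ = 2 * θ * (M : ℝ) ^ 2 := by ring
    rw [div_le_iff₀ (by positivity)]
    have h7 : (quadForm V t / (2 * (N : ℝ) ^ 2) + θ) * (2 * (M : ℝ) ^ 2) =
        (M : ℝ) ^ 2 * (quadForm V t / (N : ℝ) ^ 2) + 2 * θ * (M : ℝ) ^ 2 := by
      field_simp
    rw [h7]
    linarith
  have hlow : W ^ m * p a₀ ^ r * Y ^ (3 * (M : ℝ) / 2 - 1) ≤ configInt U Λ M (ε + 4 * θ) := by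
    refine (mul_le_mul_of_nonneg_right hWM (by positivity)).trans ?_
    exact typeWeight_mul_rpow_le_configInt hU hsymm h0 hopen.measurableSet hc hV hM t' hY0.le
      (by rw [hYdef]; linarith)
  have hlog := Real.log_le_log (by positivity) hlow
  rw [Real.log_mul (by positivity) (by positivity), Real.log_mul (by positivity) (by positivity),
    Real.log_pow, Real.log_pow, Real.log_rpow hY0] at hlog
  have hlower : Real.log W / N + 3 / 2 * Real.log Y - K / M ≤
      Real.log (configInt U Λ M (ε + 4 * θ)) / M := by
    rw [le_div_iff₀ hM']
    have e1 : (Real.log W / N + 3 / 2 * Real.log Y - K / M) * M =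
        M * (Real.log W / N) + 3 / 2 * M * Real.log Y - K := by
      field_simp
    have e2 : (M : ℝ) * (Real.log W / N) = m * Real.log W + r / N * Real.log W := by
      rw [← hmr']
      field_simp
    have e3 : (r : ℝ) / N * Real.log W ≤ |Real.log W| := by
      have h1 : (r : ℝ) / N ≤ 1 := (div_le_one hN').2 hrN
      calc (r : ℝ) / N * Real.log W ≤ r / N * |Real.log W| := by gcongr; exact le_abs_self _
        _ ≤ 1 * |Real.log W| := by gcongr
        _ = _ := one_mul _
    have e4 : -(r * Real.log (p a₀)) ≤ N * |Real.log (p a₀)| := by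
      calc -(r * Real.log (p a₀)) = r * (-Real.log (p a₀)) := by ring
        _ ≤ r * |Real.log (p a₀)| := by gcongr; exact neg_le_abs _
        _ ≤ _ := by gcongr
    have e5 := le_abs_self (Real.log Y)
    rw [e1, e2]
    linarith
  linarith

theorem integral_pair_pi {U : Euc → Euc → ℝ} (hU : Continuous fun p : Euc × Euc => U p.1 p.2)
    {B : ℝ} (h0 : ∀ x y, 0 ≤ U x y) (hB : ∀ x y, U x y ≤ B) (ρ : Measure Euc)
    [IsProbabilityMeasure ρ] {N : ℕ} {i j : Fin N} (hij : i ≠ j) :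
    ∫ q : Fin N → Euc, U (q i) (q j) ∂(Measure.pi fun _ => ρ) = 2 * pairing U ρ ρ := by
  have hind := (ProbabilityTheory.iIndepFun_pi (μ := fun _ : Fin N => ρ)
    (X := fun _ => (id : Euc → Euc)) fun _ => aemeasurable_id).indepFun hij
  have hmap := (ProbabilityTheory.indepFun_iff_map_prod_eq_prod_map_map
    (measurable_pi_apply i).aemeasurable (measurable_pi_apply j).aemeasurable).1 hind
  have hev : ∀ l : Fin N, Measure.map (fun q : Fin N → Euc => q l) (Measure.pi fun _ => ρ) = ρ :=
    fun l => (measurePreserving_eval (fun _ : Fin N => ρ) l).map_eq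
  rw [hev, hev] at hmap
  have hint : Integrable (fun p : Euc × Euc => U p.1 p.2) (ρ.prod ρ) :=
    Integrable.of_bound hU.measurable.aestronglyMeasurable B
      (Eventually.of_forall fun p => by rw [Real.norm_of_nonneg (h0 _ _)]; exact hB _ _)
  have h1 : ∫ q : Fin N → Euc, U (q i) (q j) ∂(Measure.pi fun _ => ρ) =
      ∫ p, U p.1 p.2 ∂(ρ.prod ρ) := by
    rw [← hmap, integral_map (by fun_prop) hU.measurable.aestronglyMeasurable]
  rw [h1, integral_prod _ hint, pairing]
  simp_rw [integral_div]
  ring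

theorem integral_interaction_le {U : Euc → Euc → ℝ}
    (hU : Continuous fun p : Euc × Euc => U p.1 p.2)
    {B : ℝ} (h0 : ∀ x y, 0 ≤ U x y) (hB : ∀ x y, U x y ≤ B) (ρ : Measure Euc)
    [IsProbabilityMeasure ρ] (N : ℕ) :
    Integrable (interaction U N) (Measure.pi fun _ : Fin N => ρ) ∧
    ∫ q, interaction U N q ∂(Measure.pi fun _ : Fin N => ρ) ≤ (N : ℝ) ^ 2 * pairing U ρ ρ := by
  have hint : ∀ i j : Fin N, Integrable
      (fun q : Fin N → Euc => if (i : ℕ) < (j : ℕ) then U (q i) (q j) else 0)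
      (Measure.pi fun _ => ρ) := by
    intro i j
    split_ifs
    · have hc : Continuous fun q : Fin N → Euc => U (q i) (q j) :=
        hU.comp (g := fun p : Euc × Euc => U p.1 p.2) (f := fun q : Fin N → Euc => (q i, q j))
          (by fun_prop)
      exact Integrable.of_bound hc.measurable.aestronglyMeasurable B
        (Eventually.of_forall fun p => by rw [Real.norm_of_nonneg (h0 _ _)]; exact hB _ _)
    · exact integrable_zero _ _ _
  have hP : 0 ≤ pairing U ρ ρ :=
    integral_nonneg fun x => integral_nonneg fun y => div_nonneg (h0 x y) (by norm_num)
  refine ⟨integrable_finsetSum _ fun i _ => integrable_finsetSum _ fun j _ => hint i j, ?_⟩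
  have h1 : ∫ q, interaction U N q ∂(Measure.pi fun _ : Fin N => ρ) =
      interaction (fun _ _ => 2 * pairing U ρ ρ) N fun _ => 0 := by
    unfold interaction
    rw [integral_finsetSum _ fun i _ => integrable_finsetSum _ fun j _ => hint i j]
    refine Finset.sum_congr rfl fun i _ => ?_
    rw [integral_finsetSum _ fun j _ => hint i j]
    refine Finset.sum_congr rfl fun j _ => ?_
    split_ifs with hij
    · exact integral_pair_pi hU h0 hB ρ fun h => by simp [h] at hij
    · simp
  have h2 := two_mul_interaction (U := fun _ _ => 2 * pairing U ρ ρ) (fun _ _ => rfl) N fun _ => 0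
  simp only [Finset.sum_const, Finset.card_univ, Fintype.card_fin, nsmul_eq_mul] at h2
  rw [h1]
  have h3 : 0 ≤ (N : ℝ) * (2 * pairing U ρ ρ) := by positivity
  nlinarith

theorem groundEnergy_nonneg {U : Euc → Euc → ℝ} (h0 : ∀ x y, 0 ≤ U x y) (Λ : Set Euc) :
    0 ≤ groundEnergy U Λ := by
  refine Real.sInf_nonneg ?_
  rintro _ ⟨ρ, -, rfl⟩
  exact integral_nonneg fun x => integral_nonneg fun y => div_nonneg (h0 x y) (by norm_num)

theorem configInt_pos {U : Euc → Euc → ℝ} {Λ : Set Euc} {B ε : ℝ}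
    (hU : Continuous fun p : Euc × Euc => U p.1 p.2) (h0 : ∀ x y, 0 ≤ U x y)
    (hB : ∀ x y, U x y ≤ B) (hne : Λ.Nonempty) (hopen : IsOpen Λ) (hbdd : Bornology.IsBounded Λ)
    (hε : groundEnergy U Λ < ε) {N : ℕ} (hN : 0 < N) : 0 < configInt U Λ N ε := by
  have hN' : (0 : ℝ) < N := by exact_mod_cast hN
  have hfin : IsFiniteMeasure ((volume : Measure Euc).restrict Λ) :=
    ⟨by rw [Measure.restrict_apply_univ]; exact hbdd.measure_lt_top⟩
  obtain ⟨x₀, hx₀⟩ := hne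
  obtain ⟨_, ⟨ρ, ⟨hρ, hρΛ⟩, rfl⟩, hlt⟩ := exists_lt_of_csInf_lt
    (s := {e : ℝ | ∃ ρ : Measure Euc, IsProbOn Λ ρ ∧ e = pairing U ρ ρ})
    ⟨_, Measure.dirac x₀, ⟨inferInstance, by
      rw [Measure.dirac_apply' _ isClosed_closure.measurableSet.compl]
      simp [subset_closure hx₀]⟩, rfl⟩ hε
  obtain ⟨hint, hle⟩ := integral_interaction_le hU h0 hB ρ N
  have hnull : (Measure.pi fun _ : Fin N => ρ) (⋃ i, Function.eval i ⁻¹' (closure Λ)ᶜ) = 0 := by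
    refine measure_iUnion_null fun i => ?_
    rw [(measurePreserving_eval (fun _ : Fin N => ρ) i).measure_preimage
      isClosed_closure.measurableSet.compl.nullMeasurableSet, hρΛ]
  obtain ⟨x, hx, hxle⟩ := exists_notMem_null_le_integral hint hnull
  have hxcl : x ∈ closure (Set.univ.pi fun _ : Fin N => Λ) := by
    rw [closure_pi_set]
    intro i _
    by_contra h
    exact hx (Set.mem_iUnion.2 ⟨i, h⟩)
  have hIopen : IsOpen {q : Fin N → Euc | interaction U N q < (N : ℝ) ^ 2 * ε} :=
    isOpen_lt (continuous_interaction hU N) continuous_const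
  have hxI : x ∈ {q : Fin N → Euc | interaction U N q < (N : ℝ) ^ 2 * ε} := by
    have : (N : ℝ) ^ 2 * pairing U ρ ρ < (N : ℝ) ^ 2 * ε := by gcongr
    exact (hxle.trans hle).trans_lt this
  have hmeet := mem_closure_iff.1 hxcl _ hIopen hxI
  have hΛN : IsOpen (Set.univ.pi fun _ : Fin N => Λ) :=
    isOpen_set_pi Set.finite_univ fun _ _ => hopen
  have hvol := (hIopen.inter hΛN).measure_pos volume hmeet
  refine (integral_pos_iff_support_of_nonneg_ae
    (Eventually.of_forall fun q => Real.rpow_nonneg (le_max_right _ _) _)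
    (integrable_configInt hU h0 hN ε)).2 ?_
  rw [configMeasure_eq]
  refine lt_of_lt_of_le ?_ (measure_mono (s := {q | interaction U N q < (N : ℝ) ^ 2 * ε}) ?_)
  · rwa [Measure.restrict_apply hIopen.measurableSet]
  · intro q hq
    have hq' : interaction U N q < (N : ℝ) ^ 2 * ε := hq
    have : 0 < ε - scaledInteraction U N q := by
      rw [scaledInteraction, sub_pos, div_lt_iff₀ (by positivity)]
      linarith
    rw [Function.mem_support, max_eq_left this.le]
    exact (Real.rpow_pos_of_pos this _).ne'

theorem integral_eq_mul_configInt (U : Euc → Euc → ℝ) (Λ : Set Euc) {N : ℕ} (hN : 0 < N)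
    (ε : ℝ) :
    ∫ q : Fin N → Euc in Set.univ.pi fun _ => Λ,
      (max ((N : ℝ) ^ 2 * ε - interaction U N q) 0) ^ ((3 * (N : ℝ)) / 2 - 1) ∂volume =
      ((N : ℝ) ^ 2) ^ ((3 * (N : ℝ)) / 2 - 1) * configInt U Λ N ε := by
  have hN' : (0 : ℝ) < N := by exact_mod_cast hN
  rw [configInt, truncPowInt, configMeasure_eq, ← integral_const_mul]
  congr 1
  ext q
  rw [← Real.mul_rpow (by positivity) (le_max_right _ _), mul_max_of_nonneg _ _ (by positivity),
    mul_zero, mul_sub, scaledInteraction, mul_div_cancel₀ _ (by positivity)]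

theorem exists_entropy_of_continuous {U : Euc → Euc → ℝ} {Λ : Set Euc} {B : ℝ}
    (hne : Λ.Nonempty) (hopen : IsOpen Λ) (hbdd : Bornology.IsBounded Λ)
    (hU : Continuous fun p : Euc × Euc => U p.1 p.2)
    (hsymm : ∀ x y, U x y = U y x) (h0 : ∀ x y, 0 ≤ U x y) (hB : ∀ x y, U x y ≤ B) :
    ∃ s : ℝ → ℝ,
      ContinuousOn s (Ioi (groundEnergy U Λ)) ∧
      StrictMonoOn s (Ioi (groundEnergy U Λ)) ∧
      ∀ ε : ℝ, groundEnergy U Λ < ε →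
        Tendsto (fun N : ℕ =>
            (mcEntropy U Λ N ((N : ℝ) ^ 2 * ε) + (N : ℝ) * Real.log N) / (N : ℝ))
          atTop (nhds (s ε)) := by
  have hfin : IsFiniteMeasure ((volume : Measure Euc).restrict Λ) :=
    ⟨by rw [Measure.restrict_apply_univ]; exact hbdd.measure_lt_top⟩
  have : ∀ N, IsFiniteMeasure (configMeasure Λ N) := fun N => by
    unfold configMeasure; infer_instance
  have hpos : ∀ ε > groundEnergy U Λ, ∀ N : ℕ, 0 < N → 0 < configInt U Λ N ε :=
    fun ε hε N hN => configInt_pos hU h0 hB hne hopen hbdd hε hN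
  have hv : 0 < (volume : Measure Euc).real Λ :=
    ENNReal.toReal_pos (hopen.measure_pos volume hne).ne' hbdd.measure_lt_top.ne
  obtain ⟨s, hs1, hs2, hs3⟩ := exists_limit_log_truncPowInt (configMeasure Λ)
    (scaledInteraction U)
    (fun N => ((continuous_interaction hU N).div_const _).measurable.aemeasurable)
    (fun N => Eventually.of_forall fun q => div_nonneg (interaction_nonneg h0 N q) (by positivity))
    hv (fun N => by simp [configMeasure, measureReal_def, Measure.pi_univ])
    (groundEnergy_nonneg h0 Λ) hpos
    (fun ε hε η hη δ hδ =>
      eventually_log_configInt_le hU hsymm h0 hB hne hopen hbdd (hpos ε hε) hη hδ)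
  obtain ⟨C, hC⟩ := exists_tendsto_log_prefactor
  refine ⟨fun ε => C + s ε, continuousOn_const.add hs1,
    fun x hx y hy hxy => add_lt_add_right (hs2 hx hy hxy) C, fun ε hε => ?_⟩
  refine (hC.add (hs3 ε hε)).congr' ?_
  filter_upwards [eventually_gt_atTop 0] with N hN
  have hN' : (0 : ℝ) < N := by exact_mod_cast hN
  have hG : 0 < Real.Gamma (3 * (N : ℝ) / 2) := Real.Gamma_pos_of_pos (by positivity)
  have hF : (0 : ℝ) < N.factorial := by exact_mod_cast N.factorial_pos
  rw [mcEntropy, integral_eq_mul_configInt U Λ hN, ← mul_assoc,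
    Real.log_mul (by positivity) (hpos ε hε N hN).ne', configInt]
  field_simp
  ring

/-! ### Reduction to a globally continuous interaction -/

theorem exists_continuous_extension {Λ : Set Euc} (hbdd : Bornology.IsBounded Λ)
    {U : Euc → Euc → ℝ} (h0 : ∀ x ∈ closure Λ, ∀ y ∈ closure Λ, 0 ≤ U x y)
    (hsymm : ∀ x ∈ closure Λ, ∀ y ∈ closure Λ, U x y = U y x)
    (hU : ContinuousOn (fun p : Euc × Euc => U p.1 p.2) (closure Λ ×ˢ closure Λ)) :
    ∃ (U' : Euc → Euc → ℝ) (B : ℝ), Continuous (fun p : Euc × Euc => U' p.1 p.2) ∧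
      (∀ x y, U' x y = U' y x) ∧ (∀ x y, 0 ≤ U' x y) ∧ (∀ x y, U' x y ≤ B) ∧
      ∀ x ∈ closure Λ, ∀ y ∈ closure Λ, U' x y = U x y := by
  have hK : IsCompact (closure Λ ×ˢ closure Λ) := hbdd.isCompact_closure.prod hbdd.isCompact_closure
  obtain ⟨C, hC⟩ := hK.exists_bound_of_continuousOn hU
  obtain ⟨g, hg⟩ := ContinuousMap.exists_restrict_eq hK.isClosed
    (⟨_, hU.domRestrict⟩ : C(↥(closure Λ ×ˢ closure Λ), ℝ))
  have hgU : ∀ x ∈ closure Λ, ∀ y ∈ closure Λ, g (x, y) = U x y := fun x hx y hy =>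
    DFunLike.congr_fun hg ⟨(x, y), hx, hy⟩
  refine ⟨fun x y => max 0 (min (max C 0) ((g (x, y) + g (y, x)) / 2)), max C 0, by fun_prop,
    fun x y => by simp only [add_comm], fun x y => le_max_left _ _,
    fun x y => max_le (le_max_right _ _) (min_le_left _ _), fun x hx y hy => ?_⟩
  have hle : U x y ≤ C := (le_abs_self _).trans (hC (x, y) ⟨hx, hy⟩)
  simp only [hgU x hx y hy, hgU y hy x hx, hsymm y hy x hx, add_self_div_two]
  rw [min_eq_right (hle.trans (le_max_left _ _)), max_eq_right (h0 x hx y hy)]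

theorem groundEnergy_congr {Λ : Set Euc} {U U' : Euc → Euc → ℝ}
    (h : ∀ x ∈ closure Λ, ∀ y ∈ closure Λ, U' x y = U x y) :
    groundEnergy U' Λ = groundEnergy U Λ := by
  have hp : ∀ ρ, IsProbOn Λ ρ → pairing U' ρ ρ = pairing U ρ ρ := by
    intro ρ hρ
    have hae : ∀ᵐ x ∂ρ, x ∈ closure Λ := by
      rw [ae_iff]
      exact hρ.2
    refine integral_congr_ae ?_
    filter_upwards [hae] with x hx
    refine integral_congr_ae ?_
    filter_upwards [hae] with y hy
    rw [h x hx y hy]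
  unfold groundEnergy
  congr 1
  ext e
  exact exists_congr fun ρ => and_congr_right fun hρ => by rw [hp ρ hρ]

theorem mcEntropy_congr {Λ : Set Euc} (hΛ : MeasurableSet Λ) {U U' : Euc → Euc → ℝ}
    (h : ∀ x ∈ closure Λ, ∀ y ∈ closure Λ, U' x y = U x y) (N : ℕ) (E : ℝ) :
    mcEntropy U' Λ N E = mcEntropy U Λ N E := by
  unfold mcEntropy
  congr 2
  refine setIntegral_congr_fun (MeasurableSet.univ_pi fun _ => hΛ) fun q hq => ?_
  have : interaction U' N q = interaction U N q := by
    refine Finset.sum_congr rfl fun i _ => Finset.sum_congr rfl fun j _ => ?_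
    rw [h _ (subset_closure (hq i (Set.mem_univ i))) _ (subset_closure (hq j (Set.mem_univ j)))]
  simp only [this]

theorem statement0
    (Λ : Set Euc) (hΛne : Λ.Nonempty) (hΛopen : IsOpen Λ)
    (hΛbdd : Bornology.IsBounded Λ) (hΛconn : IsConnected Λ)
    (U : Euc → Euc → ℝ)
    (hUnonneg : ∀ x ∈ closure Λ, ∀ y ∈ closure Λ, 0 ≤ U x y)
    (hUsymm : ∀ x ∈ closure Λ, ∀ y ∈ closure Λ, U x y = U y x)
    (hUcont : ContinuousOn (fun p : Euc × Euc => U p.1 p.2) (closure Λ ×ˢ closure Λ)) :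
    ∃ s : ℝ → ℝ,
      ContinuousOn s (Ioi (groundEnergy U Λ)) ∧
      StrictMonoOn s (Ioi (groundEnergy U Λ)) ∧
      ∀ ε : ℝ, groundEnergy U Λ < ε →
        Tendsto (fun N : ℕ =>
            (mcEntropy U Λ N ((N : ℝ) ^ 2 * ε) + (N : ℝ) * Real.log N) / (N : ℝ))
          atTop (nhds (s ε)) := by
  obtain ⟨U', B, hU', hsymm', h0', hB', hUU'⟩ :=
    exists_continuous_extension hΛbdd hUnonneg hUsymm hUcont
  have h := exists_entropy_of_continuous hΛne hΛopen hΛbdd hU' hsymm' h0' hB'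
  rw [groundEnergy_congr hUU'] at h
  simpa only [mcEntropy_congr hΛopen.measurableSet hUU'] using h
end
end

section
/- Assume hypotheses (H1)–(H4) on U and let ε > ε_g. Then every minimizer f_ε of Boltzmann's H functional ℋ over the constraint set 𝔄_ε factorizes: there exists a probability density ρ_ε on Λ with ⟨ρ_ε,ρ_ε⟩ < ε such that, almost everywhere, f_ε(p,q) = σ(p)·ρ_ε(q), where θ := (2/3)(ε − ⟨ρ_ε,ρ_ε⟩) > 0, σ(p) := (2πθ)^{−3/2}·exp(−|p|²/(2θ)), and ρ_ε satisfies almost everywhere the fixed point equation ρ_ε(q) = exp(−θ⁻¹∫_Λ U(q,ỹ)ρ_ε(ỹ)dỹ) / ∫_Λ exp(−θ⁻¹∫_Λ U(x,ỹ)ρ_ε(ỹ)dỹ) dx. -/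
open MeasureTheory Real Filter Set
open scoped BigOperators ENNReal

noncomputable section

/-- Interaction energy `I_N(q) = ∑_{i<j} U(q_i, q_j)` (extended-real valued). -/
def interactionE (U : Euc → Euc → ℝ≥0∞) (N : ℕ) (q : Fin N → Euc) : ℝ≥0∞ :=
  ∑ i : Fin N, ∑ j : Fin N, if (i : ℕ) < (j : ℕ) then U (q i) (q j) else 0

/-- The bilinear pairing `⟨ρ,ρ'⟩ = ∬ ½ U(x,y) ρ(dx) ρ'(dy)`. -/
def pairingE (U : Euc → Euc → ℝ≥0∞) (ρ ρ' : Measure Euc) : ℝ≥0∞ :=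
  ∫⁻ x, ∫⁻ y, U x y / 2 ∂ρ' ∂ρ

/-- `ε_g`, the infimum of `⟨ρ,ρ⟩` over Borel probability measures on `cl(Λ)`. -/
def groundEnergyE (U : Euc → Euc → ℝ≥0∞) (Λ : Set Euc) : ℝ≥0∞ :=
  ⨅ ρ ∈ {ρ : Measure Euc | IsProbOn Λ ρ}, pairingE U ρ ρ

/-- Hypotheses (H1)–(H4) on the effective pair interaction `U`. -/
structure HypUE (U : Euc → Euc → ℝ≥0∞) (Λ : Set Euc) : Prop where
  /-- (H1) Symmetry. -/
  symm : ∀ x ∈ closure Λ, ∀ y ∈ closure Λ, U x y = U y x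
  /-- (H2) Lower semicontinuity on `cl(Λ)×cl(Λ)`. -/
  lsc : LowerSemicontinuousOn (fun p : Euc × Euc => U p.1 p.2) (closure Λ ×ˢ closure Λ)
  /-- (H3) Sublevel set regularity. -/
  sublevel : ∀ δ : ℝ, 0 < δ →
    0 < volume {p : Euc × Euc | p.1 ∈ Λ ∧ p.2 ∈ Λ ∧
      U p.1 p.2 < (⨅ x ∈ closure Λ, ⨅ y ∈ closure Λ, U x y) + ENNReal.ofReal δ}
  /-- (H4) Local square integrability. -/
  locL2 : ∀ x ∈ Λ, ∃ r : ℝ, 0 < r ∧ (∫⁻ y in Metric.ball x r ∩ Λ, (U x y) ^ 2) < ⊤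

/-- Boltzmann's microcanonical entropy
`S_N(E) = ln[(2π/N)^{3N/2} (N! Γ(3N/2))⁻¹ ∫_{Λ^N} (E − I_N(q))₊^{3N/2−1} dq]`. -/
def mcEntropyE (U : Euc → Euc → ℝ≥0∞) (Λ : Set Euc) (N : ℕ) (E : ℝ) : ℝ :=
  Real.log ((2 * π / N) ^ ((3 * (N : ℝ)) / 2) *
      ((N.factorial : ℝ) * Real.Gamma (3 * (N : ℝ) / 2))⁻¹ *
    ∫ q : Fin N → Euc in Set.univ.pi fun _ => Λ,
      ((ENNReal.ofReal E - interactionE U N q).toReal) ^ ((3 * (N : ℝ)) / 2 - 1) ∂volume)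

/-- Boltzmann's H functional `ℋ(f) = ∬ f ln(f/e)`. -/
def Hfun (f : Euc × Euc → ℝ) : ℝ :=
  ∫ z : Euc × Euc, f z * (Real.log (f z) - 1)

/-- The energy functional
`ℰ(f) = ∬ ½|p|² f + ∬∬ ½U(q,q̃) f(p,q) f(p̃,q̃)` (extended-real valued). -/
def Efun (U : Euc → Euc → ℝ≥0∞) (f : Euc × Euc → ℝ) : ℝ≥0∞ :=
  (∫⁻ z : Euc × Euc, ENNReal.ofReal (‖z.1‖ ^ 2 / 2 * f z)) +
  ∫⁻ z : Euc × Euc, ∫⁻ w : Euc × Euc,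
    ENNReal.ofReal (f z) * ENNReal.ofReal (f w) * (U z.2 w.2 / 2)

/-- The constraint set `𝔄_ε`: probability densities `f` on `ℝ³×Λ` with `f·|ln f|`
integrable and `ℰ(f) = ε`. -/
def Adm (U : Euc → Euc → ℝ≥0∞) (Λ : Set Euc) (ε : ℝ) (f : Euc × Euc → ℝ) : Prop :=
  Measurable f ∧ (∀ z, 0 ≤ f z) ∧ (∀ z : Euc × Euc, z.2 ∉ Λ → f z = 0) ∧
  Integrable f ∧ (∫ z : Euc × Euc, f z) = 1 ∧
  Integrable (fun z : Euc × Euc => f z * |Real.log (f z)|) ∧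
  Efun U f = ENNReal.ofReal ε


/-- `negExp t a = exp(−t·a)` for `a ∈ [0,∞]`, with the value `0` at `a = ∞`. -/
def negExp (t : ℝ) (a : ℝ≥0∞) : ℝ :=
  if a = ⊤ then 0 else Real.exp (-(t * a.toReal))

/-- The Maxwellian density at temperature `θ`. -/
def maxwell (θ : ℝ) (p : Euc) : ℝ :=
  (2 * π * θ) ^ (-(3 : ℝ) / 2) * Real.exp (-‖p‖ ^ 2 / (2 * θ))

lemma measurable_maxwell (θ : ℝ) : Measurable (maxwell θ) := by
  unfold maxwell; fun_prop

lemma maxwell_pos {θ : ℝ} (hθ : 0 < θ) (p : Euc) : 0 < maxwell θ p := by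
  unfold maxwell; positivity

lemma log_maxwell {θ : ℝ} (hθ : 0 < θ) (p : Euc) :
    Real.log (maxwell θ p) = -(3 / 2) * Real.log (2 * π * θ) - ‖p‖ ^ 2 / (2 * θ) := by
  unfold maxwell
  rw [Real.log_mul (by positivity) (by positivity), Real.log_exp, Real.log_rpow (by positivity)]
  ring

lemma maxwell_eq {θ : ℝ} (p : Euc) :
    maxwell θ p = (2 * π * θ) ^ (-(3 : ℝ) / 2) * Real.exp (-(2 * θ)⁻¹ * ‖p‖ ^ 2) := by
  unfold maxwell; congr 2; ring

lemma integral_maxwell {θ : ℝ} (hθ : 0 < θ) : ∫ p, maxwell θ p = 1 := by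
  simp_rw [maxwell_eq]
  rw [integral_const_mul, GaussianFourier.integral_rexp_neg_mul_sq_norm (by positivity)]
  have h : π / (2 * θ)⁻¹ = 2 * π * θ := by field_simp
  rw [h, ← Real.rpow_add (by positivity)]
  simp
  norm_num

lemma integrable_maxwell {θ : ℝ} (hθ : 0 < θ) : Integrable (maxwell θ) :=
  Integrable.of_integral_ne_zero (by rw [integral_maxwell hθ]; exact one_ne_zero)

lemma integral_sq_norm_mul_exp {b : ℝ} (hb : 0 < b) :
    ∫ p : Euc, ‖p‖ ^ 2 * Real.exp (-b * ‖p‖ ^ 2) =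
      3 / (2 * b) * ∫ p : Euc, Real.exp (-b * ‖p‖ ^ 2) := by
  rw [integral_fun_norm_addHaar volume (fun y : ℝ => y ^ 2 * Real.exp (-b * y ^ 2)),
    integral_fun_norm_addHaar volume (fun y : ℝ => Real.exp (-b * y ^ 2))]
  have h4 := integral_rpow_mul_exp_neg_mul_rpow (p := 2) (q := 4) (b := b) two_pos
    (by norm_num) hb
  have h2 := integral_rpow_mul_exp_neg_mul_rpow (p := 2) (q := 2) (b := b) two_pos
    (by norm_num) hb
  norm_cast at h4 h2
  have e4 : ∀ y : ℝ, y ^ (Module.finrank ℝ Euc - 1) • (y ^ 2 * Real.exp (-b * y ^ 2)) =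
      y ^ 4 * Real.exp (-b * y ^ 2) := by intro y; simp; ring
  have e2 : ∀ y : ℝ, y ^ (Module.finrank ℝ Euc - 1) • (Real.exp (-b * y ^ 2)) =
      y ^ 2 * Real.exp (-b * y ^ 2) := by intro y; simp
  simp_rw [e4, e2]
  rw [h4, h2]
  have hG : Real.Gamma (((4 + 1 : ℕ) : ℝ) / ((2 : ℕ) : ℝ)) =
      3 / 2 * Real.Gamma (((2 + 1 : ℕ) : ℝ) / ((2 : ℕ) : ℝ)) := by
    have := Real.Gamma_add_one (s := 3 / 2) (by norm_num)
    norm_num at this ⊢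
    exact this
  have hB : b ^ (-((4 + 1 : ℕ) : ℝ) / ((2 : ℕ) : ℝ)) =
      b⁻¹ * b ^ (-((2 + 1 : ℕ) : ℝ) / ((2 : ℕ) : ℝ)) := by
    rw [← Real.rpow_neg_one, ← Real.rpow_add hb]; norm_num
  push_cast at hG hB ⊢
  rw [hG, hB]
  simp only [smul_eq_mul, nsmul_eq_mul]
  field_simp

lemma integral_sq_norm_mul_maxwell {θ : ℝ} (hθ : 0 < θ) :
    ∫ p, ‖p‖ ^ 2 * maxwell θ p = 3 * θ := by
  have h := integral_maxwell hθ
  simp_rw [maxwell_eq] at h ⊢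
  simp_rw [mul_left_comm (‖_‖ ^ 2)]
  rw [integral_const_mul] at h ⊢
  rw [integral_sq_norm_mul_exp (by positivity), mul_left_comm, h]
  field_simp

lemma integrable_sq_norm_mul_maxwell {θ : ℝ} (hθ : 0 < θ) :
    Integrable (fun p => ‖p‖ ^ 2 * maxwell θ p) :=
  Integrable.of_integral_ne_zero (by rw [integral_sq_norm_mul_maxwell hθ]; positivity)

/-- The interaction self-energy `⟨r,r⟩` of a density `r`. -/
def selfEnergy (U : Euc → Euc → ℝ≥0∞) (r : Euc → ℝ) : ℝ≥0∞ :=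
  ∫⁻ x : Euc, ∫⁻ y : Euc, ENNReal.ofReal (r x) * ENNReal.ofReal (r y) * (U x y / 2)

lemma lintegral_lintegral_interaction {U : Euc → Euc → ℝ≥0∞}
    (hU : Measurable (Function.uncurry U)) {F : Euc × Euc → ℝ≥0∞} (hF : Measurable F) :
    ∫⁻ z : Euc × Euc, ∫⁻ w : Euc × Euc, F z * F w * (U z.2 w.2 / 2) =
      ∫⁻ x, ∫⁻ y, (∫⁻ p, F (p, x)) * (∫⁻ p, F (p, y)) * (U x y / 2) := by
  have hm : Measurable fun y => ∫⁻ p, F (p, y) := hF.lintegral_prod_left'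
  have hUx : ∀ x, Measurable (U x) := fun x => hU.of_uncurry_left
  have hJ : Measurable fun x => ∫⁻ y, (∫⁻ p, F (p, y)) * (U x y / 2) :=
    Measurable.lintegral_prod_right' (f := fun z : Euc × Euc =>
      (∫⁻ p, F (p, z.2)) * (U z.1 z.2 / 2)) ((hm.comp measurable_snd).mul (hU.div_const 2))
  have inner : ∀ z : Euc × Euc, ∫⁻ w : Euc × Euc, F z * F w * (U z.2 w.2 / 2) =
      F z * ∫⁻ y, (∫⁻ p, F (p, y)) * (U z.2 y / 2) := by
    intro z
    have hw : Measurable fun w : Euc × Euc => F w * (U z.2 w.2 / 2) :=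
      hF.mul (((hUx z.2).comp measurable_snd).div_const 2)
    simp_rw [mul_assoc]
    rw [lintegral_const_mul _ hw, Measure.volume_eq_prod, lintegral_prod_symm _ hw.aemeasurable]
    congr 1
    refine lintegral_congr fun y => ?_
    have hFy : Measurable fun p => F (p, y) := hF.comp measurable_prodMk_right
    exact lintegral_mul_const (U z.2 y / 2) hFy
  simp_rw [inner]
  have hz : Measurable fun z : Euc × Euc => F z * ∫⁻ y, (∫⁻ p, F (p, y)) * (U z.2 y / 2) :=
    hF.mul (hJ.comp measurable_snd)
  rw [Measure.volume_eq_prod, lintegral_prod_symm _ hz.aemeasurable]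
  refine lintegral_congr fun x => ?_
  have hFx : Measurable fun p => F (p, x) := hF.comp measurable_prodMk_right
  simp_rw [mul_assoc]
  rw [lintegral_mul_const _ hFx,
    lintegral_const_mul _ (by have := hUx x; fun_prop)]

/-- The spatial densities which compete in the reduced variational problem. -/
structure SpatialAdm (U : Euc → Euc → ℝ≥0∞) (Λ : Set Euc) (ε : ℝ) (r : Euc → ℝ) : Prop where
  measurable : Measurable r
  nonneg : ∀ q, 0 ≤ r q
  eq_zero : ∀ q, q ∉ Λ → r q = 0
  integrable : Integrable r
  integral_eq : ∫ q, r q = 1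
  integrable_mul_log : Integrable fun q => r q * Real.log (r q)
  energy_lt : selfEnergy U r < ENNReal.ofReal ε

/-- The temperature of a spatial density at total energy `ε`. -/
def temperature (U : Euc → Euc → ℝ≥0∞) (ε : ℝ) (r : Euc → ℝ) : ℝ :=
  2 / 3 * (ε - (selfEnergy U r).toReal)

lemma SpatialAdm.temperature_pos {U : Euc → Euc → ℝ≥0∞} {Λ : Set Euc} {ε : ℝ} {r : Euc → ℝ}
    (h : SpatialAdm U Λ ε r) : 0 < temperature U ε r := by
  have := ENNReal.toReal_lt_of_lt_ofReal h.energy_lt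
  unfold temperature
  linarith

lemma efun_maxwell_mul {U : Euc → Euc → ℝ≥0∞} (hU : Measurable (Function.uncurry U))
    {r : Euc → ℝ} (hr : Measurable r) (hr0 : ∀ q, 0 ≤ r q) (hri : Integrable r)
    (hr1 : ∫ q, r q = 1) {θ : ℝ} (hθ : 0 < θ) :
    Efun U (fun z => maxwell θ z.1 * r z.2) = ENNReal.ofReal (3 / 2 * θ) + selfEnergy U r := by
  have hm := measurable_maxwell θ
  unfold Efun selfEnergy
  congr 1
  · rw [← ofReal_integral_eq_lintegral_ofReal]
    · congr 1
      have : ∀ z : Euc × Euc, ‖z.1‖ ^ 2 / 2 * (maxwell θ z.1 * r z.2) =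
          (1 / 2 * (‖z.1‖ ^ 2 * maxwell θ z.1)) * r z.2 := fun z => by ring
      simp_rw [this]
      rw [Measure.volume_eq_prod,
        integral_prod_mul (fun p : Euc => 1 / 2 * (‖p‖ ^ 2 * maxwell θ p)) r, hr1,
        integral_const_mul, integral_sq_norm_mul_maxwell hθ]
      ring
    · have := ((integrable_sq_norm_mul_maxwell hθ).const_mul (1 / 2)).mul_prod hri
      refine this.congr (ae_of_all _ fun z => ?_)
      simp only []
      ring
    · exact ae_of_all _ fun z => by have := maxwell_pos hθ z.1; have := hr0 z.2; positivity
  · rw [lintegral_lintegral_interaction hU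
      (F := fun z => ENNReal.ofReal (maxwell θ z.1 * r z.2)) (by fun_prop)]
    have : ∀ x, ∫⁻ p, ENNReal.ofReal (maxwell θ p * r x) = ENNReal.ofReal (r x) := by
      intro x
      simp_rw [ENNReal.ofReal_mul (maxwell_pos hθ _).le]
      rw [lintegral_mul_const _ (by fun_prop), ← ofReal_integral_eq_lintegral_ofReal
        (integrable_maxwell hθ) (ae_of_all _ fun p => (maxwell_pos hθ p).le),
        integral_maxwell hθ]
      simp
    simp_rw [this]

lemma maxwell_mul_log {θ : ℝ} (hθ : 0 < θ) (p : Euc) (a : ℝ) :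
    maxwell θ p * a * Real.log (maxwell θ p * a) =
      maxwell θ p * (a * Real.log a) - 3 / 2 * Real.log (2 * π * θ) * (maxwell θ p * a)
        - 1 / (2 * θ) * (‖p‖ ^ 2 * maxwell θ p * a) := by
  rcases eq_or_ne a 0 with rfl | ha
  · simp
  · rw [Real.log_mul (maxwell_pos hθ p).ne' ha, log_maxwell hθ]
    ring

lemma integral_maxwell_mul_log {r : Euc → ℝ} (hri : Integrable r) (hr1 : ∫ q, r q = 1)
    (hrl : Integrable fun q => r q * Real.log (r q)) {θ : ℝ} (hθ : 0 < θ) :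
    Integrable (fun z : Euc × Euc =>
        maxwell θ z.1 * r z.2 * Real.log (maxwell θ z.1 * r z.2)) ∧
      ∫ z : Euc × Euc, maxwell θ z.1 * r z.2 * Real.log (maxwell θ z.1 * r z.2) =
        (∫ q, r q * Real.log (r q)) - 3 / 2 * Real.log (2 * π * θ) - 3 / 2 := by
  simp_rw [maxwell_mul_log hθ]
  have h1 := (integrable_maxwell hθ).mul_prod hrl
  have h2 := ((integrable_maxwell hθ).mul_prod hri).const_mul (3 / 2 * Real.log (2 * π * θ))
  have h3 := ((integrable_sq_norm_mul_maxwell hθ).mul_prod hri).const_mul (1 / (2 * θ))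
  have h12 : Integrable (fun z : Euc × Euc => maxwell θ z.1 * (r z.2 * Real.log (r z.2)) -
      3 / 2 * Real.log (2 * π * θ) * (maxwell θ z.1 * r z.2)) (volume.prod volume) := h1.sub h2
  refine ⟨h12.sub h3, ?_⟩
  rw [Measure.volume_eq_prod, integral_sub h12 h3, integral_sub h1 h2,
    integral_const_mul, integral_const_mul,
    integral_prod_mul (maxwell θ) (fun q => r q * Real.log (r q)),
    integral_prod_mul (maxwell θ) r,
    integral_prod_mul (fun p : Euc => ‖p‖ ^ 2 * maxwell θ p) r,
    integral_maxwell hθ, integral_sq_norm_mul_maxwell hθ, hr1]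
  field_simp

lemma integral_maxwell_mul {r : Euc → ℝ} (hri : Integrable r) (hr1 : ∫ q, r q = 1)
    {θ : ℝ} (hθ : 0 < θ) :
    Integrable (fun z : Euc × Euc => maxwell θ z.1 * r z.2) ∧
      ∫ z : Euc × Euc, maxwell θ z.1 * r z.2 = 1 := by
  refine ⟨(integrable_maxwell hθ).mul_prod hri, ?_⟩
  rw [Measure.volume_eq_prod, integral_prod_mul (maxwell θ) r, integral_maxwell hθ, hr1, one_mul]

/-- A spatial density times the Maxwellian at its temperature lies in the constraint set. -/
lemma SpatialAdm.adm_maxwell {U : Euc → Euc → ℝ≥0∞} (hU : Measurable (Function.uncurry U))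
    {Λ : Set Euc} {ε : ℝ} {r : Euc → ℝ} (h : SpatialAdm U Λ ε r) :
    Adm U Λ ε (fun z => maxwell (temperature U ε r) z.1 * r z.2) := by
  have hθ := h.temperature_pos
  have hm := measurable_maxwell (temperature U ε r)
  have hr := h.measurable
  obtain ⟨hi, hi1⟩ := integral_maxwell_mul h.integrable h.integral_eq hθ
  have hl := (integral_maxwell_mul_log h.integrable h.integral_eq h.integrable_mul_log hθ).1
  have h0 : ∀ z : Euc × Euc, 0 ≤ maxwell (temperature U ε r) z.1 * r z.2 := fun z =>
    mul_nonneg (maxwell_pos hθ _).le (h.nonneg _)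
  refine ⟨by fun_prop, h0, fun z hz => by simp [h.eq_zero _ hz], hi, hi1, ?_, ?_⟩
  · refine hl.norm.congr (ae_of_all _ fun z => ?_)
    simp only [norm_mul _ (Real.log _), Real.norm_eq_abs]
    rw [abs_of_nonneg (h0 z)]
  · rw [efun_maxwell_mul hU hr h.nonneg h.integrable h.integral_eq hθ]
    have hE := h.energy_lt.ne_top
    conv_lhs => rw [← ENNReal.ofReal_toReal hE]
    rw [← ENNReal.ofReal_add (by positivity) ENNReal.toReal_nonneg]
    unfold temperature
    ring_nf

lemma SpatialAdm.hfun_maxwell {U : Euc → Euc → ℝ≥0∞}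
    {Λ : Set Euc} {ε : ℝ} {r : Euc → ℝ} (h : SpatialAdm U Λ ε r) :
    Hfun (fun z => maxwell (temperature U ε r) z.1 * r z.2) =
      (∫ q, r q * Real.log (r q)) - 3 / 2 * Real.log (2 * π * temperature U ε r) - 5 / 2 := by
  have hθ := h.temperature_pos
  obtain ⟨hi, hi1⟩ := integral_maxwell_mul h.integrable h.integral_eq hθ
  obtain ⟨hl, hl1⟩ :=
    integral_maxwell_mul_log h.integrable h.integral_eq h.integrable_mul_log hθ
  unfold Hfun
  simp_rw [mul_sub, mul_one]
  rw [integral_sub hl hi, hl1, hi1]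
  ring

lemma gibbs_nonneg {a b : ℝ} (ha : 0 ≤ a) (hb : 0 < b) :
    0 ≤ a * Real.log a - a * Real.log b - a + b := by
  rcases ha.eq_or_lt with rfl | ha
  · simpa using hb.le
  have h := Real.log_le_sub_one_of_pos (div_pos hb ha)
  rw [Real.log_div hb.ne' ha.ne'] at h
  have h2 := mul_le_mul_of_nonneg_left h ha.le
  have h3 : a * (b / a - 1) = b - a := by field_simp
  linarith

lemma eq_of_gibbs_eq_zero {a b : ℝ} (ha : 0 ≤ a) (hb : 0 < b)
    (h0 : a * Real.log a - a * Real.log b - a + b = 0) : a = b := by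
  rcases ha.eq_or_lt with rfl | ha
  · simp at h0; exact h0.symm
  by_contra hab
  have h := Real.log_lt_sub_one_of_pos (div_pos hb ha)
    (fun h => hab ((div_eq_one_iff_eq ha.ne').1 h).symm)
  rw [Real.log_div hb.ne' ha.ne'] at h
  have h2 := mul_lt_mul_of_pos_left h ha
  have h3 : a * (b / a - 1) = b - a := by field_simp
  linarith

/-- The spatial marginal of a phase space density. -/
def marginal (f : Euc × Euc → ℝ) (q : Euc) : ℝ := ∫ p, f (p, q)

section Marginal

variable {U : Euc → Euc → ℝ≥0∞} {Λ : Set Euc} {ε : ℝ} {f : Euc × Euc → ℝ}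

lemma measurable_marginal (hf : Measurable f) : Measurable (marginal f) :=
  (hf.stronglyMeasurable.integral_prod_left' (μ := volume)).measurable

lemma marginal_nonneg (hf : ∀ z, 0 ≤ f z) (q : Euc) : 0 ≤ marginal f q :=
  integral_nonneg fun _ => hf _

lemma ae_integrable_slice {g : Euc × Euc → ℝ} (hg : Integrable g) :
    ∀ᵐ q, Integrable fun p => g (p, q) :=
  Integrable.prod_left_ae (μ := volume) (ν := volume) hg

lemma integrable_marginal (hf : Integrable f) : Integrable (marginal f) :=
  Integrable.integral_prod_right (μ := volume) (ν := volume) hf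

lemma integral_marginal (hf : Integrable f) : ∫ q, marginal f q = ∫ z, f z := by
  rw [Measure.volume_eq_prod] at hf ⊢
  exact (integral_prod_symm f hf).symm

lemma ae_eq_zero_of_marginal_eq_zero (hfm : Measurable f) (hf0 : ∀ z, 0 ≤ f z)
    (hfi : Integrable f) : ∀ᵐ z, marginal f z.2 = 0 → f z = 0 := by
  have hm := measurable_marginal hfm
  rw [ae_iff, Measure.volume_eq_prod, Measure.prod_apply_symm, lintegral_eq_zero_iff']
  · filter_upwards [ae_integrable_slice hfi] with q hq
    by_cases h : marginal f q = 0
    · have := (integral_eq_zero_iff_of_nonneg (fun p => hf0 (p, q)) hq).1 h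
      refine measure_mono_null (fun p hp => ?_) (ae_iff.1 this)
      simp only [mem_preimage, mem_ofPred_eq, Classical.not_imp] at hp
      exact hp.2
    · simp [h]
  · refine (measurable_measure_prodMk_right ?_).aemeasurable
    exact ((hm.comp measurable_snd) (measurableSet_singleton 0)).imp
      (hfm (measurableSet_singleton 0)) |>.compl
  · exact ((hm.comp measurable_snd) (measurableSet_singleton 0)).imp
      (hfm (measurableSet_singleton 0)) |>.compl

lemma Adm.integrable_mul_log (hf : Adm U Λ ε f) :
    Integrable fun z => f z * Real.log (f z) := by
  obtain ⟨hfm, hf0, -, -, -, hfl, -⟩ := hf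
  refine hfl.mono (by fun_prop) (ae_of_all _ fun z => ?_)
  simp

lemma selfEnergy_marginal (hU : Measurable (Function.uncurry U)) (hf : Adm U Λ ε f) :
    (∫⁻ z : Euc × Euc, ENNReal.ofReal (‖z.1‖ ^ 2 / 2 * f z)) + selfEnergy U (marginal f) =
      ENNReal.ofReal ε := by
  obtain ⟨hfm, hf0, -, hfi, -, -, hfE⟩ := hf
  rw [← hfE]
  unfold Efun selfEnergy
  congr 1
  rw [lintegral_lintegral_interaction hU (F := fun z => ENNReal.ofReal (f z)) (by fun_prop)]
  have h : ∀ᵐ q, ENNReal.ofReal (marginal f q) = ∫⁻ p, ENNReal.ofReal (f (p, q)) := by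
    filter_upwards [ae_integrable_slice hfi] with q hq
    exact ofReal_integral_eq_lintegral_ofReal hq (ae_of_all _ fun p => hf0 _)
  refine lintegral_congr_ae ?_
  filter_upwards [h] with x hx
  refine lintegral_congr_ae ?_
  filter_upwards [h] with y hy
  rw [hx, hy]

lemma selfEnergy_marginal_lt (hU : Measurable (Function.uncurry U)) (hf : Adm U Λ ε f) :
    selfEnergy U (marginal f) < ENNReal.ofReal ε := by
  have h := selfEnergy_marginal hU hf
  obtain ⟨hfm, hf0, -, hfi, hf1, -, -⟩ := hf
  have hfin : selfEnergy U (marginal f) ≠ ⊤ :=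
    ne_top_of_le_ne_top ENNReal.ofReal_ne_top (h ▸ le_add_self)
  rw [← h, add_comm]
  refine ENNReal.lt_add_right hfin fun h0 => ?_
  rw [lintegral_eq_zero_iff (by fun_prop)] at h0
  have hne' : ∀ᵐ p : Euc, p ≠ 0 := by simp [ae_iff]
  have hne : ∀ᵐ z : Euc × Euc, z.1 ≠ 0 :=
    (Measure.quasiMeasurePreserving_fst (μ := (volume : Measure Euc))
      (ν := (volume : Measure Euc))).ae hne'
  have : f =ᵐ[volume] 0 := by
    filter_upwards [h0, hne] with z hz hz1
    have h1 : 0 < ‖z.1‖ := norm_pos_iff.2 hz1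
    have h2 := ENNReal.ofReal_eq_zero.1 hz
    have h3 : f z ≤ 0 := by
      by_contra! h4
      exact absurd h2 (not_le.2 (by positivity))
    exact le_antisymm h3 (hf0 z)
  rw [integral_congr_ae this] at hf1
  simp at hf1

lemma integral_kinetic (hU : Measurable (Function.uncurry U)) (hf : Adm U Λ ε f) :
    Integrable (fun z : Euc × Euc => ‖z.1‖ ^ 2 / 2 * f z) ∧
      ∫ z : Euc × Euc, ‖z.1‖ ^ 2 / 2 * f z = 3 / 2 * temperature U ε (marginal f) := by
  have h := selfEnergy_marginal hU hf
  have hlt := selfEnergy_marginal_lt hU hf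
  obtain ⟨hfm, hf0, -⟩ := hf
  have hε : 0 < ε := ENNReal.ofReal_pos.1 (pos_of_gt hlt)
  have h0 : ∀ z : Euc × Euc, 0 ≤ ‖z.1‖ ^ 2 / 2 * f z := fun z =>
    mul_nonneg (by positivity) (hf0 z)
  have hfin : ∫⁻ z : Euc × Euc, ENNReal.ofReal (‖z.1‖ ^ 2 / 2 * f z) ≠ ⊤ :=
    ne_top_of_le_ne_top ENNReal.ofReal_ne_top (h ▸ le_self_add)
  have hm : Measurable fun z : Euc × Euc => ‖z.1‖ ^ 2 / 2 * f z := by fun_prop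
  refine ⟨(lintegral_ofReal_ne_top_iff_integrable hm.aestronglyMeasurable
    (ae_of_all _ h0)).1 hfin, ?_⟩
  rw [integral_eq_lintegral_of_nonneg_ae (ae_of_all _ h0) hm.aestronglyMeasurable]
  have h2 := congrArg ENNReal.toReal h
  rw [ENNReal.toReal_add hfin hlt.ne_top, ENNReal.toReal_ofReal hε.le] at h2
  unfold temperature
  linarith

/-- The integrand of `∫ f ln (f / σ_θ)`. -/
def relDensity (θ : ℝ) (f : Euc × Euc → ℝ) (z : Euc × Euc) : ℝ :=
  f z * Real.log (f z) + 3 / 2 * Real.log (2 * π * θ) * f z + 1 / θ * (‖z.1‖ ^ 2 / 2 * f z)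

lemma gibbs_maxwell_eq {θ : ℝ} (hθ : 0 < θ) (z : Euc × Euc) {a : ℝ} (ha : 0 < a) :
    f z * Real.log (f z) - f z * Real.log (maxwell θ z.1 * a) - f z + maxwell θ z.1 * a =
      relDensity θ f z - f z * Real.log a - f z + maxwell θ z.1 * a := by
  rw [Real.log_mul (maxwell_pos hθ _).ne' ha.ne', log_maxwell hθ]
  unfold relDensity
  field_simp
  ring

lemma integral_relDensity (hU : Measurable (Function.uncurry U)) (hf : Adm U Λ ε f) {θ : ℝ}
    (hθ : θ = temperature U ε (marginal f)) (hθ0 : 0 < θ) :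
    Integrable (relDensity θ f) ∧ ∫ z, relDensity θ f z =
      (∫ z, f z * Real.log (f z)) + 3 / 2 * Real.log (2 * π * θ) + 3 / 2 := by
  have h1 := hf.integrable_mul_log
  obtain ⟨hk, hk1⟩ := integral_kinetic hU hf
  obtain ⟨-, -, -, hfi, hf1, -, -⟩ := hf
  have h2 := hfi.const_mul (3 / 2 * Real.log (2 * π * θ))
  have h12 : Integrable fun z => f z * Real.log (f z) + 3 / 2 * Real.log (2 * π * θ) * f z :=
    h1.add h2
  have h3 := hk.const_mul (1 / θ)
  refine ⟨h12.add h3, ?_⟩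
  unfold relDensity
  rw [integral_add h12 h3, integral_add h1 h2, integral_const_mul, integral_const_mul, hf1, hk1,
    ← hθ]
  field_simp

lemma integrable_marginal_mul_log (hU : Measurable (Function.uncurry U))
    (hΛm : MeasurableSet Λ) (hΛv : volume Λ < ⊤) (hf : Adm U Λ ε f) :
    Integrable fun q => marginal f q * Real.log (marginal f q) := by
  have hθ : 0 < temperature U ε (marginal f) := by
    have := ENNReal.toReal_lt_of_lt_ofReal (selfEnergy_marginal_lt hU hf)
    unfold temperature
    linarith
  obtain ⟨hT, -⟩ := integral_relDensity hU hf rfl hθ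
  set θ := temperature U ε (marginal f)
  obtain ⟨hfm, hf0, hfΛ, hfi, -, -, -⟩ := hf
  have hm := measurable_marginal hfm
  have hB : Integrable fun q => |marginal (relDensity θ f) q| + Λ.indicator (fun _ => (1 : ℝ)) q :=
    (integrable_marginal hT).abs.add
      ((integrable_indicator_iff hΛm).2 (integrableOn_const hΛv.ne))
  refine hB.mono' (by fun_prop) ?_
  filter_upwards [ae_integrable_slice hfi, ae_integrable_slice hT] with q hq hqT
  have hr0 := marginal_nonneg hf0 q
  by_cases hqΛ : q ∈ Λ
  swap
  · have : marginal f q = 0 := by simp [marginal, hfΛ (_, q) hqΛ]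
    simp [this, hqΛ]
  rw [Real.norm_eq_abs, indicator_of_mem hqΛ, abs_le]
  constructor
  · have := gibbs_nonneg hr0 one_pos
    have h2 := abs_nonneg (marginal (relDensity θ f) q)
    simp at this
    linarith
  · rcases hr0.eq_or_lt with h0 | h0
    · rw [← h0]; simp; positivity
    have h1 : 0 ≤ ∫ p, (relDensity θ f (p, q) - f (p, q) * Real.log (marginal f q) - f (p, q)
        + maxwell θ p * marginal f q) := by
      refine integral_nonneg fun p => ?_
      have := gibbs_nonneg (hf0 (p, q)) (mul_pos (maxwell_pos hθ p) h0)
      rwa [gibbs_maxwell_eq (z := (p, q)) hθ h0] at this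
    have i2 := hq.mul_const (Real.log (marginal f q))
    have i3 : Integrable fun p => relDensity θ f (p, q) - f (p, q) * Real.log (marginal f q) :=
      hqT.sub i2
    have i4 : Integrable fun p =>
        relDensity θ f (p, q) - f (p, q) * Real.log (marginal f q) - f (p, q) := i3.sub hq
    rw [integral_add i4 ((integrable_maxwell hθ).mul_const _), integral_sub i3 hq,
      integral_sub hqT i2, integral_mul_const, integral_mul_const, integral_maxwell hθ] at h1
    have h2 := le_abs_self (marginal (relDensity θ f) q)
    unfold marginal at h1 h2 ⊢
    linarith

lemma Adm.spatialAdm_marginal (hU : Measurable (Function.uncurry U))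
    (hΛm : MeasurableSet Λ) (hΛv : volume Λ < ⊤) (hf : Adm U Λ ε f) :
    SpatialAdm U Λ ε (marginal f) where
  measurable := measurable_marginal hf.1
  nonneg := marginal_nonneg hf.2.1
  eq_zero q hq := by simp [marginal, hf.2.2.1 (_, q) hq]
  integrable := integrable_marginal hf.2.2.2.1
  integral_eq := (integral_marginal hf.2.2.2.1).trans hf.2.2.2.2.1
  integrable_mul_log := integrable_marginal_mul_log hU hΛm hΛv hf
  energy_lt := selfEnergy_marginal_lt hU hf

lemma integral_mul_log_marginal (hfm : Measurable f) (hf0 : ∀ z, 0 ≤ f z) (hfi : Integrable f)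
    (hl : Integrable fun q => marginal f q * Real.log (marginal f q)) :
    Integrable (fun z : Euc × Euc => f z * Real.log (marginal f z.2)) ∧
      ∫ z : Euc × Euc, f z * Real.log (marginal f z.2) =
        ∫ q, marginal f q * Real.log (marginal f q) := by
  have hm := measurable_marginal hfm
  have hi : Integrable (fun z : Euc × Euc => f z * Real.log (marginal f z.2)) := by
    rw [Measure.volume_eq_prod, integrable_prod_iff' (by fun_prop)]
    constructor
    · filter_upwards [ae_integrable_slice hfi] with q hq
      exact hq.mul_const _
    · refine hl.norm.congr (ae_of_all _ fun q => ?_)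
      have : ∀ p, ‖f (p, q) * Real.log (marginal f q)‖ =
          f (p, q) * |Real.log (marginal f q)| := fun p => by
        rw [norm_mul, Real.norm_of_nonneg (hf0 _), Real.norm_eq_abs]
      simp only [this]
      rw [integral_mul_const, norm_mul, Real.norm_of_nonneg (marginal_nonneg hf0 q),
        Real.norm_eq_abs, marginal]
  refine ⟨hi, ?_⟩
  rw [Measure.volume_eq_prod] at hi ⊢
  rw [integral_prod_symm _ hi]
  refine integral_congr_ae (ae_of_all _ fun q => ?_)
  simp only [integral_mul_const]
  rfl

/-- Among the densities with given marginal and energy, only the Maxwellian minimizes `ℋ`. -/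
lemma ae_eq_maxwell_mul_marginal (hU : Measurable (Function.uncurry U))
    (hΛm : MeasurableSet Λ) (hΛv : volume Λ < ⊤) (hf : Adm U Λ ε f) {θ : ℝ}
    (hθ : θ = temperature U ε (marginal f))
    (hmin : Hfun f ≤ Hfun fun z => maxwell θ z.1 * marginal f z.2) :
    f =ᵐ[volume] fun z => maxwell θ z.1 * marginal f z.2 := by
  have hS := hf.spatialAdm_marginal hU hΛm hΛv
  have hθ0 : 0 < θ := hθ ▸ hS.temperature_pos
  obtain ⟨hT, hT1⟩ := integral_relDensity hU hf hθ hθ0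
  have hH := hS.hfun_maxwell
  rw [← hθ] at hH
  rw [hH] at hmin
  have hfl := hf.integrable_mul_log
  obtain ⟨hfm, hf0, hfΛ, hfi, hf1, -, -⟩ := hf
  obtain ⟨hL, hL1⟩ := integral_mul_log_marginal hfm hf0 hfi hS.integrable_mul_log
  obtain ⟨hM, hM1⟩ := integral_maxwell_mul hS.integrable hS.integral_eq hθ0
  have hz := ae_eq_zero_of_marginal_eq_zero hfm hf0 hfi
  have hH2 : Hfun f = (∫ z, f z * Real.log (f z)) - 1 := by
    unfold Hfun
    simp_rw [mul_sub, mul_one]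
    rw [integral_sub hfl hfi, hf1]
  have i3 : Integrable fun z => relDensity θ f z - f z * Real.log (marginal f z.2) := hT.sub hL
  have i4 : Integrable fun z => relDensity θ f z - f z * Real.log (marginal f z.2) - f z :=
    i3.sub hfi
  have i5 : Integrable fun z => relDensity θ f z - f z * Real.log (marginal f z.2) - f z +
    maxwell θ z.1 * marginal f z.2 := i4.add hM
  have hI : ∫ z, (relDensity θ f z - f z * Real.log (marginal f z.2) - f z +
      maxwell θ z.1 * marginal f z.2) ≤ 0 := by
    rw [integral_add i4 hM, integral_sub i3 hfi, integral_sub hT hL, hT1, hL1, hf1, hM1]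
    linarith
  have hpos : 0 ≤ᵐ[volume] fun z => relDensity θ f z - f z * Real.log (marginal f z.2) - f z +
      maxwell θ z.1 * marginal f z.2 := by
    filter_upwards [hz] with z hz
    rcases (hS.nonneg z.2).eq_or_lt with h0 | h0
    · simp [relDensity, hz h0.symm, ← h0]
    · have := gibbs_nonneg (hf0 z) (mul_pos (maxwell_pos hθ0 z.1) h0)
      rwa [gibbs_maxwell_eq hθ0 z h0] at this
  have h0 := (integral_eq_zero_iff_of_nonneg_ae hpos i5).1
    (le_antisymm hI (integral_nonneg_of_ae hpos))
  filter_upwards [h0, hz] with z hz0 hz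
  rcases (hS.nonneg z.2).eq_or_lt with h0 | h0
  · simp [hz h0.symm, ← h0]
  · refine eq_of_gibbs_eq_zero (hf0 z) (mul_pos (maxwell_pos hθ0 z.1) h0) ?_
    rw [gibbs_maxwell_eq hθ0 z h0]
    exact hz0

/-- The marginal of a minimizer of `ℋ` minimizes the reduced functional. -/
lemma reduced_minimality (hU : Measurable (Function.uncurry U))
    (hΛm : MeasurableSet Λ) (hΛv : volume Λ < ⊤) (hf : Adm U Λ ε f)
    (hfmin : ∀ g, Adm U Λ ε g → Hfun f ≤ Hfun g) {r : Euc → ℝ} (hr : SpatialAdm U Λ ε r) :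
    (∫ q, marginal f q * Real.log (marginal f q)) -
        3 / 2 * Real.log (2 * π * temperature U ε (marginal f)) ≤
      (∫ q, r q * Real.log (r q)) - 3 / 2 * Real.log (2 * π * temperature U ε r) := by
  have hS := hf.spatialAdm_marginal hU hΛm hΛv
  have hae := ae_eq_maxwell_mul_marginal hU hΛm hΛv hf rfl (hfmin _ (hS.adm_maxwell hU))
  have h1 : Hfun f = Hfun fun z => maxwell (temperature U ε (marginal f)) z.1 * marginal f z.2 :=
    integral_congr_ae (hae.mono fun z hz => by simp only [hz])
  have h2 := hfmin _ (hr.adm_maxwell hU)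
  rw [h1, hS.hfun_maxwell, hr.hfun_maxwell] at h2
  linarith

end Marginal

lemma descent_contradiction {θ ε e S u w c δ : ℝ} (hθ : 0 < θ) (hδ : 0 < δ)
    (he : θ = 2 / 3 * (ε - e))
    (h : ∀ t, 0 < t → (e + t * u + t ^ 2 * w) / (1 + t) ^ 2 < ε →
      S - 3 / 2 * Real.log (2 * π * θ) ≤
        (S + t * (S + 2 * e / θ - δ - u / θ + t * c + 1)) / (1 + t) - Real.log (1 + t) -
          3 / 2 * Real.log (2 * π * (2 / 3 * (ε - (e + t * u + t ^ 2 * w) / (1 + t) ^ 2)))) :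
    False := by
  have hid : HasDerivAt (fun t : ℝ => t) 1 0 := hasDerivAt_id 0
  have h1t : HasDerivAt (fun t : ℝ => 1 + t) 1 0 := hid.const_add 1
  have hen : HasDerivAt (fun t : ℝ => (e + t * u + t ^ 2 * w) / (1 + t) ^ 2) (u - 2 * e) 0 := by
    have := (((hid.mul_const u).const_add e).add ((hid.pow 2).mul_const w)).div (h1t.pow 2)
      (by norm_num)
    refine this.congr_deriv ?_
    simp
    ring
  have hlog : HasDerivAt (fun t : ℝ => Real.log (1 + t)) 1 0 := by
    refine (h1t.log (by norm_num)).congr_deriv (by norm_num)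
  have hlt : HasDerivAt (fun t : ℝ => Real.log (2 * π *
      (2 / 3 * (ε - (e + t * u + t ^ 2 * w) / (1 + t) ^ 2)))) (-(2 / 3) * (u - 2 * e) / θ) 0 := by
    have h2 := (((hen.const_sub ε).const_mul (2 / 3)).const_mul (2 * π)).log (by
      simp [hθ.ne', ← he])
    refine h2.congr_deriv ?_
    simp [← he]
    field_simp
    ring
  have hS : HasDerivAt (fun t : ℝ =>
      (S + t * (S + 2 * e / θ - δ - u / θ + t * c + 1)) / (1 + t))
      (2 * e / θ - δ - u / θ + 1) 0 := by
    have := ((hid.mul (((hid.mul_const c).const_add (S + 2 * e / θ - δ - u / θ)).add_const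
      1)).const_add S).div h1t (by norm_num)
    refine this.congr_deriv ?_
    simp
    ring
  have hG := (hS.sub hlog).sub (hlt.const_mul (3 / 2))
  have hd : 2 * e / θ - δ - u / θ + 1 - 1 - 3 / 2 * (-(2 / 3) * (u - 2 * e) / θ) = -δ := by
    field_simp; ring
  rw [hd] at hG
  have hslope := hG.tendsto_slope_zero_right.eventually (gt_mem_nhds (neg_lt_zero.2 hδ))
  have hlt2 : ∀ᶠ t in nhdsWithin (0 : ℝ) (Ioi 0),
      (e + t * u + t ^ 2 * w) / (1 + t) ^ 2 < ε := by
    refine (hen.continuousAt.eventually (gt_mem_nhds ?_)).filter_mono nhdsWithin_le_nhds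
    simp
    linarith
  obtain ⟨t, ⟨hs, ht⟩, htpos⟩ := ((hslope.and hlt2).and self_mem_nhdsWithin).exists
  have htpos : 0 < t := htpos
  simp [← he] at hs
  have h3 := mul_nonneg (inv_pos.2 htpos).le (sub_nonneg.2 (h t htpos ht))
  linarith

/-- The potential generated by a density. -/
def potential (U : Euc → Euc → ℝ≥0∞) (r : Euc → ℝ) (q : Euc) : ℝ≥0∞ :=
  ∫⁻ y, ENNReal.ofReal (r y) * U q y

lemma measurable_potential {U : Euc → Euc → ℝ≥0∞} (hU : Measurable (Function.uncurry U))
    {r : Euc → ℝ} (hr : Measurable r) : Measurable (potential U r) :=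
  Measurable.lintegral_prod_right' (f := fun z : Euc × Euc =>
    ENNReal.ofReal (r z.2) * U z.1 z.2)
    ((hr.comp measurable_snd).ennreal_ofReal.mul hU)

/-- The bilinear form `∬ U(x,y) m(x) n(y)` on nonnegative functions. -/
def interactionForm (U : Euc → Euc → ℝ≥0∞) (m n : Euc → ℝ≥0∞) : ℝ≥0∞ :=
  ∫⁻ x, m x * ∫⁻ y, n y * U x y

section Form

variable {U : Euc → Euc → ℝ≥0∞} {m m' n n' : Euc → ℝ≥0∞}

lemma measurable_lintegral_mul (hU : Measurable (Function.uncurry U)) (hn : Measurable n) :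
    Measurable fun x => ∫⁻ y, n y * U x y :=
  Measurable.lintegral_prod_right' (f := fun z : Euc × Euc => n z.2 * U z.1 z.2)
    ((hn.comp measurable_snd).mul hU)

lemma measurable_slice (hU : Measurable (Function.uncurry U)) (x : Euc) : Measurable (U x) :=
  hU.of_uncurry_left

lemma interactionForm_comm (hU : Measurable (Function.uncurry U)) (hs : ∀ x y, U x y = U y x)
    (hm : Measurable m) (hn : Measurable n) :
    interactionForm U m n = interactionForm U n m := by
  unfold interactionForm
  have h1 : ∀ x, m x * ∫⁻ y, n y * U x y = ∫⁻ y, m x * (n y * U x y) := fun x =>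
    (lintegral_const_mul _ (hn.mul (measurable_slice hU x))).symm
  have h2 : ∀ y, n y * ∫⁻ x, m x * U y x = ∫⁻ x, m x * (n y * U x y) := fun y => by
    have hmy : Measurable fun x => m x * U y x := hm.mul (measurable_slice hU y)
    rw [← lintegral_const_mul _ hmy]
    refine lintegral_congr fun x => ?_
    rw [hs y x]
    ring
  simp_rw [h1, h2]
  refine lintegral_lintegral_swap ?_
  exact ((hm.comp measurable_fst).mul ((hn.comp measurable_snd).mul hU)).aemeasurable

lemma interactionForm_add_left (hU : Measurable (Function.uncurry U))
    (hm : Measurable m) (hn : Measurable n) :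
    interactionForm U (m + m') n = interactionForm U m n + interactionForm U m' n := by
  unfold interactionForm
  simp_rw [Pi.add_apply, add_mul]
  exact lintegral_add_left (hm.mul (measurable_lintegral_mul hU hn)) _

lemma interactionForm_const_mul_left (hU : Measurable (Function.uncurry U)) (c : ℝ≥0∞)
    (hm : Measurable m) (hn : Measurable n) :
    interactionForm U (fun x => c * m x) n = c * interactionForm U m n := by
  unfold interactionForm
  simp_rw [mul_assoc]
  exact lintegral_const_mul _ (hm.mul (measurable_lintegral_mul hU hn))

lemma interactionForm_add_self (hU : Measurable (Function.uncurry U))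
    (hs : ∀ x y, U x y = U y x) (hm : Measurable m) (hn : Measurable n) :
    interactionForm U (m + n) (m + n) =
      interactionForm U m m + 2 * interactionForm U n m + interactionForm U n n := by
  rw [interactionForm_add_left hU hm (hm.add hn),
    interactionForm_comm hU hs hm (hm.add hn), interactionForm_comm hU hs hn (hm.add hn),
    interactionForm_add_left hU hm hm, interactionForm_add_left hU hm hn,
    interactionForm_comm hU hs hm hn]
  ring

lemma interactionForm_const_mul_self (hU : Measurable (Function.uncurry U))
    (hs : ∀ x y, U x y = U y x) (c : ℝ≥0∞) (hm : Measurable m) :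
    interactionForm U (fun x => c * m x) (fun x => c * m x) = c ^ 2 * interactionForm U m m := by
  rw [interactionForm_const_mul_left hU c hm (hm.const_mul c),
    interactionForm_comm hU hs hm (hm.const_mul c), interactionForm_const_mul_left hU c hm hm]
  ring

lemma selfEnergy_eq (hU : Measurable (Function.uncurry U)) {r : Euc → ℝ} (hr : Measurable r) :
    selfEnergy U r =
      interactionForm U (fun x => ENNReal.ofReal (r x)) (fun x => ENNReal.ofReal (r x)) / 2 := by
  have hm : Measurable fun x => ENNReal.ofReal (r x) := hr.ennreal_ofReal
  have hmU : Measurable fun x =>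
      ENNReal.ofReal (r x) * ∫⁻ y, ENNReal.ofReal (r y) * U x y :=
    hm.mul (measurable_lintegral_mul hU hm)
  unfold selfEnergy interactionForm
  rw [div_eq_mul_inv, ← lintegral_mul_const _ hmU]
  refine lintegral_congr fun x => ?_
  have hx : Measurable fun y => ENNReal.ofReal (r y) * U x y := hm.mul (measurable_slice hU x)
  rw [mul_assoc, ← lintegral_mul_const _ hx, ← lintegral_const_mul _ (hx.mul_const _)]
  refine lintegral_congr fun y => ?_
  rw [div_eq_mul_inv]
  ring

lemma selfEnergy_eq_lintegral_potential (hU : Measurable (Function.uncurry U)) {r : Euc → ℝ}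
    (hr : Measurable r) :
    ∫⁻ x, ENNReal.ofReal (r x) * potential U r x = 2 * selfEnergy U r := by
  rw [selfEnergy_eq hU hr, ENNReal.mul_div_cancel (by simp) (by simp)]
  rfl

lemma interactionForm_indicator_left {B : Set Euc} (hB : MeasurableSet B) :
    interactionForm U (B.indicator 1) n = ∫⁻ x in B, ∫⁻ y, n y * U x y := by
  unfold interactionForm
  rw [← lintegral_indicator hB]
  refine lintegral_congr fun x => ?_
  by_cases hx : x ∈ B <;> simp [hx]

lemma interactionForm_indicator {B : Set Euc} (hB : MeasurableSet B) :
    interactionForm U (B.indicator 1) (B.indicator 1) = ∫⁻ x in B, ∫⁻ y in B, U x y := by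
  rw [interactionForm_indicator_left hB]
  refine lintegral_congr fun x => ?_
  rw [← lintegral_indicator hB]
  refine lintegral_congr fun y => ?_
  by_cases hy : y ∈ B <;> simp [hy]

lemma selfEnergy_perturb (hU : Measurable (Function.uncurry U)) (hs : ∀ x y, U x y = U y x)
    {r : Euc → ℝ} (hr : Measurable r) (hr0 : ∀ q, 0 ≤ r q) {B : Set Euc} (hB : MeasurableSet B)
    {a b : ℝ} (ha : 0 ≤ a) (hb : 0 ≤ b) :
    selfEnergy U (fun q => a * (r q + b * B.indicator 1 q)) =
      ENNReal.ofReal a ^ 2 * (selfEnergy U r + ENNReal.ofReal b * (∫⁻ q in B, potential U r q) +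
        ENNReal.ofReal b ^ 2 * (∫⁻ x in B, ∫⁻ y in B, U x y) / 2) := by
  have hχ : Measurable (B.indicator (1 : Euc → ℝ≥0∞)) := measurable_one.indicator hB
  have hχ' : Measurable (B.indicator (1 : Euc → ℝ)) := measurable_one.indicator hB
  have hm : Measurable fun x => ENNReal.ofReal (r x) := hr.ennreal_ofReal
  have hbχ : Measurable fun q => ENNReal.ofReal b * B.indicator 1 q := hχ.const_mul _
  have hsum := hm.add hbχ
  have hg : ∀ q, ENNReal.ofReal (a * (r q + b * B.indicator 1 q)) = ENNReal.ofReal a *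
      ((fun q => ENNReal.ofReal (r q)) + fun q => ENNReal.ofReal b * B.indicator 1 q) q := by
    intro q
    have h1 : (0 : ℝ) ≤ B.indicator 1 q := indicator_nonneg (fun _ _ => zero_le_one) q
    rw [ENNReal.ofReal_mul ha, ENNReal.ofReal_add (hr0 q) (mul_nonneg hb h1),
      ENNReal.ofReal_mul hb, Pi.add_apply]
    by_cases hq : q ∈ B <;> simp [hq]
  rw [selfEnergy_eq hU (by fun_prop), selfEnergy_eq hU hr]
  simp_rw [hg]
  rw [interactionForm_const_mul_self hU hs _ hsum, interactionForm_add_self hU hs hm hbχ,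
    interactionForm_const_mul_self hU hs _ hχ, interactionForm_const_mul_left hU _ hχ hm,
    interactionForm_indicator hB, interactionForm_indicator_left hB, mul_div_assoc,
    ENNReal.add_div, ENNReal.add_div, ENNReal.mul_div_right_comm (a := 2),
    ENNReal.div_self (by simp) (by simp), one_mul]
  rfl

end Form

section EulerLagrange

variable {U : Euc → Euc → ℝ≥0∞} {Λ : Set Euc} {ε : ℝ} {ρ : Euc → ℝ}

/-- The Lagrange multiplier `∫ ρ (ln ρ + θ⁻¹ Uρ)` of the normalization constraint. -/
def chemicalPotential (U : Euc → Euc → ℝ≥0∞) (ε : ℝ) (ρ : Euc → ℝ) : ℝ :=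
  (∫ q, ρ q * Real.log (ρ q)) + 2 * (selfEnergy U ρ).toReal / temperature U ε ρ

lemma mul_log_add_le {x a b b₀ : ℝ} (hx : 0 ≤ x) (ha : 0 < a) (hb₀ : 0 < b₀) (hb : b₀ ≤ b)
    (hxb : x ≤ b) :
    (x + a) * Real.log (x + a) ≤ x * Real.log x + a * (Real.log b + a / b₀ + 1) := by
  have hbpos : 0 < b := hb₀.trans_le hb
  have h1 := gibbs_nonneg hx (add_pos_of_nonneg_of_pos hx ha)
  have h2 : Real.log (x + a) ≤ Real.log b + a / b₀ := by
    calc Real.log (x + a) ≤ Real.log (b * (1 + a / b)) := by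
          apply Real.log_le_log (by positivity)
          have : b * (1 + a / b) = b + a := by field_simp
          linarith
      _ = Real.log b + Real.log (1 + a / b) := by
          rw [Real.log_mul hbpos.ne' (by positivity)]
      _ ≤ Real.log b + a / b := by
          have := Real.log_le_sub_one_of_pos (show 0 < 1 + a / b by positivity)
          linarith
      _ ≤ Real.log b + a / b₀ := by gcongr
  have h3 := mul_le_mul_of_nonneg_left h2 ha.le
  nlinarith

lemma integrable_mul_log_perturb (hm : Measurable ρ) (h0 : ∀ q, 0 ≤ ρ q)
    (hl : Integrable fun q => ρ q * Real.log (ρ q)) {B : Set Euc} (hB : MeasurableSet B)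
    (hBv : volume B ≠ ⊤) {K : ℝ} (hK : ∀ q ∈ B, ρ q ≤ K) {b : ℝ} (hb : 0 ≤ b) :
    Integrable fun q => (ρ q + b * B.indicator 1 q) * Real.log (ρ q + b * B.indicator 1 q) := by
  obtain ⟨L, hL⟩ := (isCompact_Icc (a := (0 : ℝ)) (b := K + b)).exists_bound_of_continuousOn
    Real.continuous_mul_log.continuousOn
  have hχ : Measurable (B.indicator (1 : Euc → ℝ)) := measurable_one.indicator hB
  have h1 : IntegrableOn
      (fun q => (ρ q + b * B.indicator 1 q) * Real.log (ρ q + b * B.indicator 1 q)) B := by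
    refine Measure.integrableOn_of_bounded (M := L) hBv (by fun_prop) ?_
    refine (ae_restrict_iff' hB).2 (ae_of_all _ fun q hq => hL _ ⟨?_, ?_⟩)
    · simp [hq]; linarith [h0 q]
    · simp [hq]; exact hK q hq
  have h2 : IntegrableOn
      (fun q => (ρ q + b * B.indicator 1 q) * Real.log (ρ q + b * B.indicator 1 q)) Bᶜ :=
    hl.integrableOn.congr_fun (fun q hq => by simp [(mem_compl_iff _ _).1 hq]) hB.compl
  rw [← integrableOn_univ, ← union_compl_self B]
  exact h1.union h2

lemma toReal_quadratic {x y z : ℝ≥0∞} (hx : x ≠ ⊤) (hy : y ≠ ⊤) (hz : z ≠ ⊤) {a b : ℝ}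
    (ha : 0 ≤ a) (hb : 0 ≤ b) :
    ENNReal.ofReal a ^ 2 * (x + ENNReal.ofReal b * y + ENNReal.ofReal b ^ 2 * z / 2) =
      ENNReal.ofReal (a ^ 2 * (x.toReal + b * y.toReal + b ^ 2 * z.toReal / 2)) := by
  have h2 : ENNReal.ofReal b ^ 2 * z / 2 ≠ ⊤ := by finiteness
  rw [← ENNReal.toReal_eq_toReal_iff' (by finiteness) (by finiteness), ENNReal.toReal_mul,
    ENNReal.toReal_add (by finiteness) h2, ENNReal.toReal_add hx (by finiteness),
    ENNReal.toReal_div, ENNReal.toReal_mul, ENNReal.toReal_mul, ENNReal.toReal_pow,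
    ENNReal.toReal_pow, ENNReal.toReal_ofReal ha, ENNReal.toReal_ofReal hb,
    ENNReal.toReal_ofReal (by positivity)]
  simp

lemma SpatialAdm.no_descent (hU : Measurable (Function.uncurry U))
    (hs : ∀ x y, U x y = U y x) (hρ : SpatialAdm U Λ ε ρ)
    (hmin : ∀ r, SpatialAdm U Λ ε r →
      (∫ q, ρ q * Real.log (ρ q)) - 3 / 2 * Real.log (2 * π * temperature U ε ρ) ≤
        (∫ q, r q * Real.log (r q)) - 3 / 2 * Real.log (2 * π * temperature U ε r))
    {B : Set Euc} (hB : MeasurableSet B) (hBΛ : B ⊆ Λ) (hBv : volume B ≠ ⊤)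
    (hBU : ∫⁻ x in B, ∫⁻ y in B, U x y ≠ ⊤) {M δ : ℝ} (hM : 0 ≤ M) (hδ : 0 < δ)
    (hBW : ∀ q ∈ B, potential U ρ q ≤ ENNReal.ofReal M)
    (hBρ : ∀ q ∈ B, ρ q ≤ Real.exp (chemicalPotential U ε ρ - δ -
      (potential U ρ q).toReal / temperature U ε ρ)) :
    volume B = 0 := by
  by_contra hB0
  have hθ := hρ.temperature_pos
  have hWm := measurable_potential hU hρ.measurable
  have hρm := hρ.measurable
  have hρ0 := hρ.nonneg
  have hε : 0 < ε := ENNReal.ofReal_pos.1 (pos_of_gt hρ.energy_lt)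
  have hχ : Measurable (B.indicator (1 : Euc → ℝ)) := measurable_one.indicator hB
  set A := chemicalPotential U ε ρ - δ with hA
  set θ := temperature U ε ρ with hθdef
  set W := potential U ρ with hW
  have hv : 0 < volume.real B := ENNReal.toReal_pos hB0 hBv
  have hWB : ∀ᵐ q ∂(volume.restrict B), W q ≤ ENNReal.ofReal M :=
    (ae_restrict_iff' hB).2 (ae_of_all _ hBW)
  have hWfin : ∫⁻ q in B, W q ≠ ⊤ := by
    refine ne_top_of_le_ne_top ?_ (lintegral_mono_ae hWB)
    rw [setLIntegral_const]
    finiteness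
  have hWint : IntegrableOn (fun q => (W q).toReal) B :=
    integrable_toReal_of_lintegral_ne_top hWm.aemeasurable hWfin
  have hWI : ∫ q in B, (W q).toReal = (∫⁻ q in B, W q).toReal :=
    integral_toReal hWm.aemeasurable (hWB.mono fun q hq => hq.trans_lt ENNReal.ofReal_lt_top)
  set k := (volume.real B)⁻¹ with hk
  have hkpos : 0 < k := inv_pos.2 hv
  have hkv : k * volume.real B = 1 := inv_mul_cancel₀ hv.ne'
  set b₀ := Real.exp (A - M / θ) with hb₀
  refine descent_contradiction (S := ∫ q, ρ q * Real.log (ρ q)) (e := (selfEnergy U ρ).toReal)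
    (u := k * (∫⁻ q in B, W q).toReal)
    (w := k ^ 2 * (∫⁻ x in B, ∫⁻ y in B, U x y).toReal / 2)
    (c := k / b₀) hθ hδ hθdef fun t ht hen => ?_
  have h1t : 0 < 1 + t := by linarith
  have htk : 0 < t * k := mul_pos ht hkpos
  set g : Euc → ℝ := fun q => ρ q + t * k * B.indicator 1 q with hg
  set r : Euc → ℝ := fun q => (1 + t)⁻¹ * g q with hr
  have hg0 : ∀ q, 0 ≤ g q := fun q =>
    add_nonneg (hρ0 q) (mul_nonneg htk.le (indicator_nonneg (fun _ _ => zero_le_one) q))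
  have hχi : Integrable fun q => t * k * B.indicator (1 : Euc → ℝ) q :=
    ((integrable_indicator_iff hB).2 (integrableOn_const hBv)).const_mul _
  have hgi : Integrable g := hρ.integrable.add hχi
  have hg1 : ∫ q, g q = 1 + t := by
    rw [hg, integral_add hρ.integrable hχi, hρ.integral_eq, integral_const_mul,
      integral_indicator_one hB, mul_assoc, hkv, mul_one]
  have hgl : Integrable fun q => g q * Real.log (g q) := by
    refine integrable_mul_log_perturb hρm hρ0 hρ.integrable_mul_log hB hBv (K := Real.exp A)
      (fun q hq => (hBρ q hq).trans ?_) htk.le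
    rw [Real.exp_le_exp]
    have : 0 ≤ (W q).toReal / θ := by positivity
    linarith
  have hE : selfEnergy U r = ENNReal.ofReal (((selfEnergy U ρ).toReal +
      t * (k * (∫⁻ q in B, W q).toReal) +
      t ^ 2 * (k ^ 2 * (∫⁻ x in B, ∫⁻ y in B, U x y).toReal / 2)) / (1 + t) ^ 2) := by
    rw [hr, selfEnergy_perturb hU hs hρm hρ0 hB (by positivity) htk.le,
      toReal_quadratic hρ.energy_lt.ne_top hWfin hBU (by positivity) htk.le]
    congr 1
    field_simp
  have hrl : ∀ q, r q * Real.log (r q) =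
      (1 + t)⁻¹ * (g q * Real.log (g q) - Real.log (1 + t) * g q) := by
    intro q
    rcases (hg0 q).eq_or_lt with h0 | h0
    · simp [hr, ← h0]
    · simp only [hr]
      rw [Real.log_mul (by positivity) h0.ne', Real.log_inv]
      ring
  have hgl' : Integrable fun q => g q * Real.log (g q) - Real.log (1 + t) * g q :=
    hgl.sub (hgi.const_mul _)
  have hrS : SpatialAdm U Λ ε r :=
    { measurable := by fun_prop
      nonneg := fun q => mul_nonneg (by positivity) (hg0 q)
      eq_zero := fun q hq => by
        have hqB : q ∉ B := fun h => hq (hBΛ h)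
        simp [hr, hg, hρ.eq_zero q hq, hqB]
      integrable := hgi.const_mul _
      integral_eq := by
        rw [hr, integral_const_mul, hg1, inv_mul_cancel₀ h1t.ne']
      integrable_mul_log := by
        simp_rw [hrl]
        exact hgl'.const_mul _
      energy_lt := by
        rw [hE]
        exact (ENNReal.ofReal_lt_ofReal_iff hε).2 hen }
  have hrT : temperature U ε r = 2 / 3 * (ε - ((selfEnergy U ρ).toReal +
      t * (k * (∫⁻ q in B, W q).toReal) +
      t ^ 2 * (k ^ 2 * (∫⁻ x in B, ∫⁻ y in B, U x y).toReal / 2)) / (1 + t) ^ 2) := by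
    rw [temperature, hE, ENNReal.toReal_ofReal (by positivity)]
  have hQi : IntegrableOn (fun q => t * k * (A - (W q).toReal / θ + t * k / b₀ + 1)) B :=
    (((((integrableOn_const hBv).sub (hWint.div_const θ)).add (integrableOn_const hBv)).add
      (integrableOn_const hBv)).const_mul (t * k))
  have hQ : ∫ q in B, t * k * (A - (W q).toReal / θ + t * k / b₀ + 1) =
      t * (A - k * (∫⁻ q in B, W q).toReal / θ + t * (k / b₀) + 1) := by
    have h2 : ∀ q, t * k * (A - (W q).toReal / θ + t * k / b₀ + 1) =
      t * k * (A + t * k / b₀ + 1) - t * k / θ * (W q).toReal := fun q => by ring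
    have hc : Integrable (fun _ : Euc => t * k * (A + t * k / b₀ + 1)) (volume.restrict B) :=
      integrableOn_const hBv
    have hW' : Integrable (fun q => t * k / θ * (W q).toReal) (volume.restrict B) :=
      hWint.const_mul _
    simp_rw [h2]
    rw [integral_sub hc hW', setIntegral_const,
      integral_const_mul, hWI, smul_eq_mul]
    linear_combination (t * (A + t * k / b₀ + 1)) * hkv
  have hpt : ∀ q, g q * Real.log (g q) ≤ ρ q * Real.log (ρ q) +
      B.indicator (fun q => t * k * (A - (W q).toReal / θ + t * k / b₀ + 1)) q := by
    intro q
    by_cases hq : q ∈ B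
    · have hWM : (W q).toReal ≤ M := ENNReal.toReal_le_of_le_ofReal hM (hBW q hq)
      have := mul_log_add_le (hρ0 q) htk (Real.exp_pos (A - M / θ))
        (Real.exp_le_exp.2 (by gcongr : A - M / θ ≤ A - (W q).toReal / θ)) (hBρ q hq)
      rw [Real.log_exp] at this
      simpa [hg, hq] using this
    · simp [hg, hq]
  have hint : ∫ q, g q * Real.log (g q) ≤ (∫ q, ρ q * Real.log (ρ q)) +
      t * (A - k * (∫⁻ q in B, W q).toReal / θ + t * (k / b₀) + 1) := by
    rw [← hQ, ← integral_indicator hB, ← integral_add hρ.integrable_mul_log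
      ((integrable_indicator_iff hB).2 hQi)]
    exact integral_mono hgl (hρ.integrable_mul_log.add
      ((integrable_indicator_iff hB).2 hQi)) hpt
  refine (hmin r hrS).trans ?_
  rw [hrT]
  simp_rw [hrl]
  rw [integral_const_mul, integral_sub hgl (hgi.const_mul _), integral_const_mul, hg1]
  have h3 : (1 + t)⁻¹ * ((∫ q, g q * Real.log (g q)) - Real.log (1 + t) * (1 + t)) =
      (∫ q, g q * Real.log (g q)) / (1 + t) - Real.log (1 + t) := by field_simp
  rw [h3]
  have hAeq : A = (∫ q, ρ q * Real.log (ρ q)) + 2 * (selfEnergy U ρ).toReal / θ - δ := hA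
  rw [hAeq] at hint
  gcongr

end EulerLagrange

section FixedPoint

variable {U : Euc → Euc → ℝ≥0∞} {Λ : Set Euc} {ε : ℝ} {ρ : Euc → ℝ}

lemma measurable_lintegral_ball (hU : Measurable (Function.uncurry U)) (hΛm : MeasurableSet Λ)
    (R : ℝ) : Measurable fun q => ∫⁻ y in Metric.ball q R ∩ Λ, U q y := by
  have hS : MeasurableSet ({z : Euc × Euc | dist z.2 z.1 < R} ∩ Prod.snd ⁻¹' Λ) :=
    (measurableSet_lt (measurable_snd.dist measurable_fst) measurable_const).inter
      (measurable_snd hΛm)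
  have h := Measurable.lintegral_prod_right' (ν := (volume : Measure Euc)) (hU.indicator hS)
  convert h using 2 with q
  rw [← lintegral_indicator (Metric.isOpen_ball.measurableSet.inter hΛm)]
  rfl

/-- The Gibbs density is bounded by the minimizer wherever the potential is finite. -/
lemma SpatialAdm.exp_le_of_minimal (hU : Measurable (Function.uncurry U))
    (hs : ∀ x y, U x y = U y x) (hΛm : MeasurableSet Λ) (hΛv : volume Λ < ⊤)
    (hloc : ∀ x ∈ Λ, ∃ r > 0, ∫⁻ y in Metric.ball x r ∩ Λ, U x y < ⊤)
    (hρ : SpatialAdm U Λ ε ρ)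
    (hmin : ∀ r, SpatialAdm U Λ ε r →
      (∫ q, ρ q * Real.log (ρ q)) - 3 / 2 * Real.log (2 * π * temperature U ε ρ) ≤
        (∫ q, r q * Real.log (r q)) - 3 / 2 * Real.log (2 * π * temperature U ε r)) :
    ∀ᵐ q, q ∈ Λ → potential U ρ q ≠ ⊤ →
      Real.exp (chemicalPotential U ε ρ - (potential U ρ q).toReal / temperature U ε ρ) ≤ ρ q := by
  have hWm := measurable_potential hU hρ.measurable
  have hρm := hρ.measurable
  set C := chemicalPotential U ε ρ with hC
  set θ := temperature U ε ρ with hθ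
  set W := potential U ρ with hW
  let D : ℕ → Set Euc := fun n => {q | q ∈ Λ ∧ W q ≤ n ∧
    ρ q ≤ Real.exp (C - 1 / ((n : ℝ) + 1) - (W q).toReal / θ) ∧
    ∫⁻ y in Metric.ball q (1 / ((n : ℝ) + 1)) ∩ Λ, U q y ≤ n}
  have hDm : ∀ n, MeasurableSet (D n) := fun n =>
    hΛm.inter ((measurableSet_le hWm measurable_const).inter
      ((measurableSet_le hρm (by fun_prop)).inter
        (measurableSet_le (measurable_lintegral_ball hU hΛm _) measurable_const)))
  have hD0 : ∀ n, volume (D n) = 0 := by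
    intro n
    refine measure_null_of_locally_null _ fun x _ => ?_
    have hn : (0 : ℝ) < 1 / ((n : ℝ) + 1) := by positivity
    set B := Metric.ball x (1 / ((n : ℝ) + 1) / 2) ∩ D n with hB
    have hBD : B ⊆ D n := inter_subset_right
    have hBΛ : B ⊆ Λ := fun q hq => (hBD hq).1
    have hBm : MeasurableSet B := Metric.isOpen_ball.measurableSet.inter (hDm n)
    have hBv : volume B ≠ ⊤ := ((measure_mono hBΛ).trans_lt hΛv).ne
    refine ⟨B, inter_mem (mem_nhdsWithin_of_mem_nhds
      (Metric.ball_mem_nhds x (half_pos hn))) self_mem_nhdsWithin, ?_⟩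
    refine hρ.no_descent hU hs hmin hBm hBΛ hBv ?_ (M := n) (Nat.cast_nonneg n) hn
      (fun q hq => ?_) fun q hq => (hBD hq).2.2.1
    · have hle : ∫⁻ q in B, ∫⁻ y in B, U q y ≤ ∫⁻ _ in B, n := by
        refine setLIntegral_mono measurable_const fun q hq => ?_
        have hsub : B ⊆ Metric.ball q (1 / ((n : ℝ) + 1)) ∩ Λ := fun y hy => ⟨?_, hBΛ hy⟩
        · exact (lintegral_mono_set hsub).trans (hBD hq).2.2.2
        have h1 := Metric.mem_ball.1 hq.1
        have h2 := Metric.mem_ball.1 hy.1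
        have h3 := dist_triangle_right y q x
        rw [Metric.mem_ball]
        linarith
      refine ne_top_of_le_ne_top ?_ hle
      rw [setLIntegral_const]
      finiteness
    · rw [ENNReal.ofReal_natCast]
      exact (hBD hq).2.1
  refine measure_mono_null (fun q hq => ?_) (measure_iUnion_null hD0)
  simp only [mem_compl_iff, mem_ofPred_eq, Classical.not_imp, not_le] at hq
  obtain ⟨hqΛ, hqW, hqρ⟩ := hq
  obtain ⟨R, hR, hUR⟩ := hloc q hqΛ
  have hlog : ∃ δ > 0, ρ q ≤ Real.exp (C - δ - (W q).toReal / θ) := by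
    have hcont : Continuous fun δ : ℝ => Real.exp (C - δ - (W q).toReal / θ) := by fun_prop
    have h := (hcont.tendsto 0).eventually_const_lt (by simpa using hqρ)
    obtain ⟨d, hd, hball⟩ := Metric.eventually_nhds_iff.1 h
    refine ⟨d / 2, half_pos hd, (hball ?_).le⟩
    rw [Real.dist_eq, sub_zero, abs_of_pos (half_pos hd)]
    linarith
  obtain ⟨δ, hδ, hρδ⟩ := hlog
  obtain ⟨n₁, hn₁⟩ := ENNReal.exists_nat_gt hqW
  obtain ⟨n₂, hn₂⟩ := ENNReal.exists_nat_gt hUR.ne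
  obtain ⟨n₃, hn₃⟩ := exists_nat_one_div_lt (lt_min hR hδ)
  have hn₃' : ∀ n, n₃ ≤ n → 1 / ((n : ℝ) + 1) ≤ min R δ := fun n hn =>
    (Nat.one_div_le_one_div hn).trans hn₃.le
  set n := max n₁ (max n₂ n₃) with hn
  have h1 : n₁ ≤ n := le_max_left _ _
  have h2 : n₂ ≤ n := (le_max_left _ _).trans (le_max_right _ _)
  have h3 := hn₃' n ((le_max_right _ _).trans (le_max_right _ _))
  refine mem_iUnion.2 ⟨n, hqΛ, hn₁.le.trans (by exact_mod_cast h1), hρδ.trans ?_, ?_⟩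
  · rw [Real.exp_le_exp]
    linarith [min_le_right R δ]
  · refine (lintegral_mono_set (inter_subset_inter_left _
      (Metric.ball_subset_ball (h3.trans (min_le_left _ _))))).trans ?_
    exact hn₂.le.trans (by exact_mod_cast h2)

theorem SpatialAdm.fixed_point (hU : Measurable (Function.uncurry U))
    (hs : ∀ x y, U x y = U y x) (hΛm : MeasurableSet Λ) (hΛv : volume Λ < ⊤)
    (hloc : ∀ x ∈ Λ, ∃ r > 0, ∫⁻ y in Metric.ball x r ∩ Λ, U x y < ⊤)
    (hρ : SpatialAdm U Λ ε ρ)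
    (hmin : ∀ r, SpatialAdm U Λ ε r →
      (∫ q, ρ q * Real.log (ρ q)) - 3 / 2 * Real.log (2 * π * temperature U ε ρ) ≤
        (∫ q, r q * Real.log (r q)) - 3 / 2 * Real.log (2 * π * temperature U ε r)) :
    ∀ᵐ q ∂(volume.restrict Λ), ρ q = negExp (temperature U ε ρ)⁻¹ (potential U ρ q) /
      ∫ x in Λ, negExp (temperature U ε ρ)⁻¹ (potential U ρ x) := by
  have hWm := measurable_potential hU hρ.measurable
  have hρm := hρ.measurable
  have hlow := hρ.exp_le_of_minimal hU hs hΛm hΛv hloc hmin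
  have hWI := selfEnergy_eq_lintegral_potential hU hρm
  have hθ := hρ.temperature_pos
  set C := chemicalPotential U ε ρ with hC
  set θ := temperature U ε ρ with hθdef
  set W := potential U ρ with hW
  have hfin : ∫⁻ q, ENNReal.ofReal (ρ q) * W q ≠ ⊤ := by
    rw [hWI]
    have := hρ.energy_lt.ne_top
    finiteness
  have hm : Measurable fun q => ENNReal.ofReal (ρ q) * W q := by fun_prop
  have htop := ae_lt_top hm hfin
  have hreal : ∀ q, (ENNReal.ofReal (ρ q) * W q).toReal = ρ q * (W q).toReal := fun q => by
    rw [ENNReal.toReal_mul, ENNReal.toReal_ofReal (hρ.nonneg q)]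
  have hint : Integrable fun q => ρ q * (W q).toReal := by
    simpa only [hreal] using integrable_toReal_of_lintegral_ne_top hm.aemeasurable hfin
  have hval : ∫ q, ρ q * (W q).toReal = 2 * (selfEnergy U ρ).toReal := by
    simp_rw [← hreal]
    rw [integral_toReal hm.aemeasurable htop, hWI, ENNReal.toReal_mul]
    simp
  have hzero : ∀ᵐ q, W q = ⊤ → ρ q = 0 := by
    filter_upwards [htop] with q hq hqW
    by_contra hne
    rw [hqW, ENNReal.mul_top] at hq
    · exact hq.ne rfl
    · simpa using lt_of_le_of_ne (hρ.nonneg q) (Ne.symm hne)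
  have hnn : ∀ᵐ q, 0 ≤ ρ q * Real.log (ρ q) + θ⁻¹ * (ρ q * (W q).toReal) - C * ρ q := by
    filter_upwards [hlow, hzero] with q hq hz
    by_cases hqΛ : q ∈ Λ
    · by_cases hqW : W q = ⊤
      · simp [hz hqW]
      · have hle := hq hqΛ hqW
        have hpos := (Real.exp_pos _).trans_le hle
        have hlog := (Real.le_log_iff_exp_le hpos).2 hle
        have hmul := mul_nonneg hpos.le (sub_nonneg.2 hlog)
        rw [div_eq_inv_mul] at hmul
        linarith
    · simp [hρ.eq_zero q hqΛ]
  have hI : Integrable fun q => ρ q * Real.log (ρ q) + θ⁻¹ * (ρ q * (W q).toReal) :=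
    hρ.integrable_mul_log.add (hint.const_mul _)
  have hI0 : ∫ q, (ρ q * Real.log (ρ q) + θ⁻¹ * (ρ q * (W q).toReal) - C * ρ q) = 0 := by
    rw [integral_sub hI (hρ.integrable.const_mul C),
      integral_add hρ.integrable_mul_log (hint.const_mul _), integral_const_mul,
      integral_const_mul, hval, hρ.integral_eq, hC, chemicalPotential, ← hθdef]
    ring
  have heq := (integral_eq_zero_iff_of_nonneg_ae hnn (hI.sub (hρ.integrable.const_mul C))).1 hI0
  have hgibbs : ∀ᵐ q, q ∈ Λ → ρ q = Real.exp C * negExp θ⁻¹ (W q) := by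
    filter_upwards [hlow, hzero, heq] with q hq hz hq0 hqΛ
    by_cases hqW : W q = ⊤
    · simp [hz hqW, hqW, negExp]
    · have hpos := (Real.exp_pos _).trans_le (hq hqΛ hqW)
      have h1 : ρ q * (Real.log (ρ q) + θ⁻¹ * (W q).toReal - C) = 0 := by
        rw [Pi.zero_apply] at hq0
        linear_combination hq0
      have h2 := (mul_eq_zero.1 h1).resolve_left hpos.ne'
      rw [negExp, if_neg hqW, ← Real.exp_add, ← Real.exp_log hpos]
      congr 1
      linarith
  have hnorm : Real.exp C * ∫ x in Λ, negExp θ⁻¹ (W x) = 1 := by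
    rw [← integral_const_mul, ← setIntegral_congr_ae hΛm hgibbs,
      setIntegral_eq_integral_of_forall_compl_eq_zero hρ.eq_zero, hρ.integral_eq]
  refine (ae_restrict_iff' hΛm).2 (hgibbs.mono fun q hq hqΛ => ?_)
  rw [hq hqΛ, eq_div_iff (right_ne_zero_of_mul_eq_one hnorm), mul_right_comm, hnorm, one_mul]

end FixedPoint

/-- The interaction `U` cut off to zero outside `Λ × Λ`. -/
def cutoff (U : Euc → Euc → ℝ≥0∞) (Λ : Set Euc) (x y : Euc) : ℝ≥0∞ :=
  (Λ ×ˢ Λ).indicator (Function.uncurry U) (x, y)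

section Cutoff

variable {U : Euc → Euc → ℝ≥0∞} {Λ : Set Euc}

lemma cutoff_apply {x y : Euc} (hx : x ∈ Λ) (hy : y ∈ Λ) : cutoff U Λ x y = U x y :=
  indicator_of_mem (mk_mem_prod hx hy) _

lemma HypUE.measurable_cutoff (hU : HypUE U Λ) (hΛ : IsOpen Λ) :
    Measurable (Function.uncurry (cutoff U Λ)) := by
  refine measurable_of_Ioi fun a => ?_
  obtain ⟨u, hu, h⟩ := lowerSemicontinuousOn_iff_preimage_Ioi.1
    (hU.lsc.mono (prod_mono subset_closure subset_closure)) a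
  have : Function.uncurry (cutoff U Λ) ⁻¹' Ioi a = (Λ ×ˢ Λ) ∩ u := by
    rw [← h]
    ext ⟨x, y⟩
    by_cases hz : (x, y) ∈ Λ ×ˢ Λ
    · simp [cutoff, Function.uncurry, hz]
    · simp [cutoff, Function.uncurry, hz]
  rw [this]
  exact ((hΛ.prod hΛ).inter hu).measurableSet

lemma HypUE.cutoff_comm (hU : HypUE U Λ) (x y : Euc) : cutoff U Λ x y = cutoff U Λ y x := by
  by_cases h : x ∈ Λ ∧ y ∈ Λ
  · rw [cutoff_apply h.1 h.2, cutoff_apply h.2 h.1,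
      hU.symm x (subset_closure h.1) y (subset_closure h.2)]
  · have h' : ¬(y ∈ Λ ∧ x ∈ Λ) := fun hc => h hc.symm
    simp [cutoff, indicator, h, h']

lemma HypUE.exists_lintegral_cutoff_lt_top (hU : HypUE U Λ) (hΛ : IsOpen Λ)
    (hΛv : volume Λ < ⊤) {x : Euc} (hx : x ∈ Λ) :
    ∃ r > 0, ∫⁻ y in Metric.ball x r ∩ Λ, cutoff U Λ x y < ⊤ := by
  obtain ⟨r, hr, h⟩ := hU.locL2 x hx
  have hv : volume (Metric.ball x r ∩ Λ) < ⊤ := (measure_mono inter_subset_right).trans_lt hΛv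
  have hm : MeasurableSet (Metric.ball x r ∩ Λ) := (Metric.isOpen_ball.inter hΛ).measurableSet
  refine ⟨r, hr, lt_of_le_of_lt ?_ (ENNReal.add_lt_top.2 ⟨hv, h⟩)⟩
  rw [← setLIntegral_one, ← lintegral_add_left measurable_const]
  refine setLIntegral_mono' hm fun y hy => ?_
  rw [cutoff_apply hx hy.2]
  rcases le_total (U x y) 1 with h1 | h1
  · exact h1.trans le_self_add
  · exact (le_self_pow h1 two_ne_zero).trans le_add_self

lemma interaction_cutoff {m n : ℝ} {x y : Euc} (hx : x ∉ Λ → m = 0) (hy : y ∉ Λ → n = 0) :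
    ENNReal.ofReal m * ENNReal.ofReal n * (cutoff U Λ x y / 2) =
      ENNReal.ofReal m * ENNReal.ofReal n * (U x y / 2) := by
  by_cases hxΛ : x ∈ Λ
  · by_cases hyΛ : y ∈ Λ
    · rw [cutoff_apply hxΛ hyΛ]
    · simp [hy hyΛ]
  · simp [hx hxΛ]

lemma selfEnergy_cutoff {r : Euc → ℝ} (hr : ∀ q, q ∉ Λ → r q = 0) :
    selfEnergy (cutoff U Λ) r = selfEnergy U r :=
  lintegral_congr fun x => lintegral_congr fun y => interaction_cutoff (hr x) (hr y)

lemma efun_cutoff {g : Euc × Euc → ℝ} (hg : ∀ z : Euc × Euc, z.2 ∉ Λ → g z = 0) :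
    Efun (cutoff U Λ) g = Efun U g := by
  unfold Efun
  congr 1
  exact lintegral_congr fun z => lintegral_congr fun w => interaction_cutoff (hg z) (hg w)

lemma adm_cutoff {ε : ℝ} {g : Euc × Euc → ℝ} : Adm (cutoff U Λ) Λ ε g ↔ Adm U Λ ε g := by
  constructor <;> rintro ⟨h1, h2, h3, h4, h5, h6, h7⟩ <;> refine ⟨h1, h2, h3, h4, h5, h6, ?_⟩
  · rwa [← efun_cutoff h3]
  · rwa [efun_cutoff h3]

lemma potential_cutoff {r : Euc → ℝ} (hΛm : MeasurableSet Λ) (hr : ∀ q, q ∉ Λ → r q = 0)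
    {q : Euc} (hq : q ∈ Λ) :
    potential (cutoff U Λ) r q = ∫⁻ y in Λ, ENNReal.ofReal (r y) * U q y := by
  rw [← lintegral_indicator hΛm]
  refine lintegral_congr fun y => ?_
  by_cases hy : y ∈ Λ
  · rw [indicator_of_mem hy, cutoff_apply hq hy]
  · simp [hy, hr y hy]

end Cutoff

theorem statement4
    (Λ : Set Euc) (hΛne : Λ.Nonempty) (hΛopen : IsOpen Λ)
    (hΛbdd : Bornology.IsBounded Λ) (hΛconn : IsConnected Λ)
    (U : Euc → Euc → ℝ≥0∞) (hU : HypUE U Λ)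
    (ε : ℝ) (hε : groundEnergyE U Λ < ENNReal.ofReal ε)
    (f : Euc × Euc → ℝ) (hf : Adm U Λ ε f)
    (hfmin : ∀ g : Euc × Euc → ℝ, Adm U Λ ε g → Hfun f ≤ Hfun g) :
    ∃ r : Euc → ℝ, Measurable r ∧ (∀ q, 0 ≤ r q) ∧ (∀ q, q ∉ Λ → r q = 0) ∧
      (∫ q : Euc, r q) = 1 ∧
      (∫⁻ x : Euc, ∫⁻ y : Euc,
          ENNReal.ofReal (r x) * ENNReal.ofReal (r y) * (U x y / 2)) <
        ENNReal.ofReal ε ∧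
      (let θ : ℝ := 2 / 3 * (ε -
          (∫⁻ x : Euc, ∫⁻ y : Euc,
            ENNReal.ofReal (r x) * ENNReal.ofReal (r y) * (U x y / 2)).toReal)
       0 < θ ∧
       (∀ᵐ z : Euc × Euc ∂volume,
          f z = (2 * π * θ) ^ (-(3 : ℝ) / 2) *
              Real.exp (-‖z.1‖ ^ 2 / (2 * θ)) * r z.2) ∧
       (∀ᵐ q : Euc ∂(volume.restrict Λ),
          r q =
            negExp θ⁻¹ (∫⁻ y in Λ, ENNReal.ofReal (r y) * U q y) /
              ∫ x in Λ, negExp θ⁻¹ (∫⁻ y in Λ, ENNReal.ofReal (r y) * U x y))) := by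
  have hΛm := hΛopen.measurableSet
  have hΛv : volume Λ < ⊤ := hΛbdd.measure_lt_top
  have hV := hU.measurable_cutoff hΛopen
  have hf' : Adm (cutoff U Λ) Λ ε f := adm_cutoff.2 hf
  have hfmin' : ∀ g, Adm (cutoff U Λ) Λ ε g → Hfun f ≤ Hfun g :=
    fun g hg => hfmin g (adm_cutoff.1 hg)
  have hr := hf'.spatialAdm_marginal hV hΛm hΛv
  have hsE : selfEnergy (cutoff U Λ) (marginal f) = selfEnergy U (marginal f) :=
    selfEnergy_cutoff hr.eq_zero
  have hT : temperature (cutoff U Λ) ε (marginal f) = temperature U ε (marginal f) := by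
    rw [temperature, hsE, temperature]
  have hEL := hr.fixed_point hV hU.cutoff_comm hΛm hΛv
    (fun x hx => hU.exists_lintegral_cutoff_lt_top hΛopen hΛv hx)
    fun r hr' => reduced_minimality hV hΛm hΛv hf' hfmin' hr'
  have hpot : ∀ q ∈ Λ, potential (cutoff U Λ) (marginal f) q =
      ∫⁻ y in Λ, ENNReal.ofReal (marginal f y) * U q y :=
    fun q hq => potential_cutoff hΛm hr.eq_zero hq
  have hθ := hr.temperature_pos
  have hlt := hr.energy_lt
  have hfact := ae_eq_maxwell_mul_marginal hV hΛm hΛv hf' rfl (hfmin' _ (hr.adm_maxwell hV))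
  rw [hT] at hEL hθ hfact
  rw [hsE] at hlt
  refine ⟨marginal f, hr.measurable, hr.nonneg, hr.eq_zero, hr.integral_eq, hlt, hθ, hfact, ?_⟩
  rw [setIntegral_congr_fun hΛm fun q hq => congrArg _ (hpot q hq)] at hEL
  refine (ae_restrict_iff' hΛm).2 (((ae_restrict_iff' hΛm).1 hEL).mono fun q hq hqΛ => ?_)
  rw [← hpot q hqΛ]
  exact hq hqΛ
end
end
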